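/- arXiv:0704.2797 — 2 statements merged into one kernel-verified Lean document; each statement's English description precedes it below -/
import Mathlib

section
/- Let T be a second countable, locally compact, Hausdorff space, W ⊆ ℝ^n open, N ≥ 1, and fix 0 ≤ δ < ρ ≤ 1. Let (m_j)_{j≥1} be a sequence of real numbers with m_j → −∞, let k = max_j m_j, and for r ≥ 2 let m̄_r = max_{j≥r} m_j. Suppose for each j that F_j : T × W × ℝ^N → ℂ is a continuous family with values in S^{m_j}_{ρ,δ}(W × ℝ^N). Then there exists a continuous family F with values in S^{k}_{ρ,δ}(W × ℝ^N) such that for every r ≥ 2, the function F − Σ_{j=1}^{r−1} F_j is a continuous family with values in S^{m̄_r}_{ρ,δ}(W × ℝ^N); moreover F is unique up to a smoothing family: if F' is another such function, then F − F' is a continuous family with values in S^{m}_{ρ,δ}(W × ℝ^N) for every m ∈ ℝ. (The continuous-families version of Shubin's Proposition 3.5, proved in Section 4 of the paper.) -/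
open MeasureTheory Filter

/-- Partial derivative of a symbol `a(x, θ)` in the `i`-th coordinate of the
spatial variable `x`. -/
noncomputable def pdX {n N : ℕ} (i : Fin n)
    (a : (Fin n → ℝ) → (Fin N → ℝ) → ℂ) : (Fin n → ℝ) → (Fin N → ℝ) → ℂ :=
  fun x θ => fderiv ℝ (fun x' => a x' θ) x (Pi.single i 1)

/-- Partial derivative of a symbol `a(x, θ)` in the `i`-th coordinate of the
frequency variable `θ`. -/
noncomputable def pdTheta {n N : ℕ} (i : Fin N)
    (a : (Fin n → ℝ) → (Fin N → ℝ) → ℂ) : (Fin n → ℝ) → (Fin N → ℝ) → ℂ :=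
  fun x θ => fderiv ℝ (fun θ' => a x θ') θ (Pi.single i 1)

/-- The iterated partial derivative `∂^α_θ ∂^β_x a` of a symbol, where the multi-indices
`α`, `β` are recorded as lists `Lθ`, `Lx` of coordinate directions (the length of the list
is the total order `|α|`, resp. `|β|`, of the multi-index). -/
noncomputable def symbolDeriv {n N : ℕ} (Lx : List (Fin n)) (Lθ : List (Fin N))
    (a : (Fin n → ℝ) → (Fin N → ℝ) → ℂ) : (Fin n → ℝ) → (Fin N → ℝ) → ℂ :=
  Lx.foldr pdX (Lθ.foldr pdTheta a)

/-- The japanese-bracket weight `⟨θ⟩^s = (1 + |θ|²)^(s/2)`. -/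
noncomputable def jweight {N : ℕ} (s : ℝ) (θ : Fin N → ℝ) : ℝ :=
  (1 + ‖θ‖ ^ 2) ^ (s / 2 : ℝ)

/-- The Hörmander class `S^m_{ρ,δ}(W × ℝ^N)`: `a` is smooth on `W × ℝ^N` and every iterated
derivative `∂^α_θ ∂^β_x a` is bounded on `K × ℝ^N` (`K ⊆ W` compact) by a constant times
`⟨θ⟩^(m - ρ|α| + δ|β|)`. -/
def IsHormanderSymbol {n N : ℕ} (ρ δ m : ℝ) (W : Set (Fin n → ℝ))
    (a : (Fin n → ℝ) → (Fin N → ℝ) → ℂ) : Prop :=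
  ContDiffOn ℝ (⊤ : ℕ∞) (fun p : (Fin n → ℝ) × (Fin N → ℝ) => a p.1 p.2) (W ×ˢ Set.univ) ∧
  ∀ K : Set (Fin n → ℝ), K ⊆ W → IsCompact K →
    ∀ (Lx : List (Fin n)) (Lθ : List (Fin N)), ∃ C : ℝ, 0 ≤ C ∧
      ∀ x ∈ K, ∀ θ : Fin N → ℝ,
        ‖symbolDeriv Lx Lθ a x θ‖ ≤
          C * jweight (m - ρ * (Lθ.length : ℝ) + δ * (Lx.length : ℝ)) θ

/-- A continuous family over `T` with values in `S^m_{ρ,δ}(W × ℝ^N)` : each `a t` lies in the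
class, and `t ↦ a t` is continuous for the Fréchet seminorm topology, i.e. for each `t₀`,
compact `K ⊆ W` and multi-indices, the corresponding seminorm of `a t - a t₀` is eventually
smaller than any `ε > 0`. -/
def IsContinuousSymbolFamily {T : Type*} [TopologicalSpace T] {n N : ℕ}
    (ρ δ m : ℝ) (W : Set (Fin n → ℝ))
    (a : T → (Fin n → ℝ) → (Fin N → ℝ) → ℂ) : Prop :=
  (∀ t, IsHormanderSymbol ρ δ m W (a t)) ∧
  ∀ t₀ : T, ∀ K : Set (Fin n → ℝ), K ⊆ W → IsCompact K →
    ∀ (Lx : List (Fin n)) (Lθ : List (Fin N)), ∀ ε : ℝ, 0 < ε →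
      ∀ᶠ t in nhds t₀, ∀ x ∈ K, ∀ θ : Fin N → ℝ,
        ‖symbolDeriv Lx Lθ (fun x' θ' => a t x' θ' - a t₀ x' θ') x θ‖ ≤
          ε * jweight (m - ρ * (Lθ.length : ℝ) + δ * (Lx.length : ℝ)) θ

/-- Smoothness of a symbol on a set of pairs `(x, θ)`. -/
def SymbolSmoothOn {n N : ℕ} (U : Set ((Fin n → ℝ) × (Fin N → ℝ)))
    (a : (Fin n → ℝ) → (Fin N → ℝ) → ℂ) : Prop :=
  ContDiffOn ℝ (⊤ : ℕ∞) (fun p : (Fin n → ℝ) × (Fin N → ℝ) => a p.1 p.2) U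

/-- Iterated partial derivatives of a function of the frequency variable alone. -/
noncomputable def thetaDeriv {N : ℕ} (L : List (Fin N)) (c : (Fin N → ℝ) → ℂ) :
    (Fin N → ℝ) → ℂ :=
  L.foldr (fun i f θ => fderiv ℝ f θ (Pi.single i 1)) c

section Weight

variable {N : ℕ}

lemma one_le_jweight_base (θ : Fin N → ℝ) : 1 ≤ 1 + ‖θ‖ ^ 2 := by
  nlinarith [sq_nonneg ‖θ‖]

lemma jweight_pos (s : ℝ) (θ : Fin N → ℝ) : 0 < jweight s θ :=
  Real.rpow_pos_of_pos (by linarith [one_le_jweight_base θ]) _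

lemma jweight_mono {s s' : ℝ} (h : s ≤ s') (θ : Fin N → ℝ) : jweight s θ ≤ jweight s' θ :=
  Real.rpow_le_rpow_of_exponent_le (one_le_jweight_base θ) (by linarith)

lemma jweight_add (s s' : ℝ) (θ : Fin N → ℝ) :
    jweight (s + s') θ = jweight s θ * jweight s' θ := by
  rw [jweight, jweight, jweight, ← Real.rpow_add (by linarith [one_le_jweight_base θ]), add_div]

lemma norm_le_jweight_one (θ : Fin N → ℝ) : ‖θ‖ ≤ jweight 1 θ := by
  rw [jweight, ← Real.sqrt_eq_rpow]
  exact Real.le_sqrt_of_sq_le (by linarith)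

lemma jweight_natCast (k : ℕ) (θ : Fin N → ℝ) : jweight (k : ℝ) θ = jweight 1 θ ^ k := by
  rw [jweight, jweight, ← Real.rpow_mul_natCast (by linarith [one_le_jweight_base θ])]
  congr 1
  ring

lemma jweight_zero (θ : Fin N → ℝ) : jweight 0 θ = 1 := by simp [jweight]

lemma continuous_jweight (s : ℝ) : Continuous (jweight s : (Fin N → ℝ) → ℝ) := by
  unfold jweight
  refine Continuous.rpow_const (by fun_prop) fun θ => Or.inl ?_
  linarith [one_le_jweight_base θ]

end Weight

section Calculus

variable {n N : ℕ} {U : Set ((Fin n → ℝ) × (Fin N → ℝ))}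
  {a b : (Fin n → ℝ) → (Fin N → ℝ) → ℂ}

lemma SymbolSmoothOn.hasFDerivAt (ha : SymbolSmoothOn U a) (hU : IsOpen U)
    {x : Fin n → ℝ} {θ : Fin N → ℝ} (h : (x, θ) ∈ U) :
    HasFDerivAt (fun p : (Fin n → ℝ) × (Fin N → ℝ) => a p.1 p.2)
      (fderiv ℝ (fun p : (Fin n → ℝ) × (Fin N → ℝ) => a p.1 p.2) (x, θ)) (x, θ) :=
  ((ContDiffOn.differentiableOn ha (by simp)).differentiableAt (hU.mem_nhds h)).hasFDerivAt

lemma SymbolSmoothOn.hasFDerivAt_left (ha : SymbolSmoothOn U a) (hU : IsOpen U)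
    {x : Fin n → ℝ} {θ : Fin N → ℝ} (h : (x, θ) ∈ U) :
    HasFDerivAt (fun x' => a x' θ)
      ((fderiv ℝ (fun p : (Fin n → ℝ) × (Fin N → ℝ) => a p.1 p.2) (x, θ)).comp
        (ContinuousLinearMap.inl ℝ _ _)) x :=
  HasFDerivAt.comp (f := fun x' => (x', θ)) x (ha.hasFDerivAt hU h)
    (hasFDerivAt_prodMk_left x θ)

lemma SymbolSmoothOn.hasFDerivAt_right (ha : SymbolSmoothOn U a) (hU : IsOpen U)
    {x : Fin n → ℝ} {θ : Fin N → ℝ} (h : (x, θ) ∈ U) :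
    HasFDerivAt (fun θ' => a x θ')
      ((fderiv ℝ (fun p : (Fin n → ℝ) × (Fin N → ℝ) => a p.1 p.2) (x, θ)).comp
        (ContinuousLinearMap.inr ℝ _ _)) θ :=
  HasFDerivAt.comp (f := fun θ' => (x, θ')) θ (ha.hasFDerivAt hU h)
    (hasFDerivAt_prodMk_right x θ)

lemma SymbolSmoothOn.pdX (ha : SymbolSmoothOn U a) (hU : IsOpen U) (i : Fin n) :
    SymbolSmoothOn U (pdX i a) := by
  have h : ContDiffOn ℝ (⊤ : ℕ∞) (fun p => fderiv ℝ
      (fun p : (Fin n → ℝ) × (Fin N → ℝ) => a p.1 p.2) p (Pi.single i 1, 0)) U :=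
    (ContDiffOn.fderiv_of_isOpen ha hU (by simp)).clm_apply contDiffOn_const
  refine h.congr fun p hp => ?_
  simp [_root_.pdX, (ha.hasFDerivAt_left hU hp).fderiv]

lemma SymbolSmoothOn.pdTheta (ha : SymbolSmoothOn U a) (hU : IsOpen U) (i : Fin N) :
    SymbolSmoothOn U (pdTheta i a) := by
  have h : ContDiffOn ℝ (⊤ : ℕ∞) (fun p => fderiv ℝ
      (fun p : (Fin n → ℝ) × (Fin N → ℝ) => a p.1 p.2) p (0, Pi.single i 1)) U :=
    (ContDiffOn.fderiv_of_isOpen ha hU (by simp)).clm_apply contDiffOn_const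
  refine h.congr fun p hp => ?_
  simp [_root_.pdTheta, (ha.hasFDerivAt_right hU hp).fderiv]

lemma SymbolSmoothOn.foldr_pdTheta (ha : SymbolSmoothOn U a) (hU : IsOpen U)
    (L : List (Fin N)) : SymbolSmoothOn U (L.foldr _root_.pdTheta a) := by
  induction L with
  | nil => exact ha
  | cons i L ih => exact ih.pdTheta hU i

lemma SymbolSmoothOn.symbolDeriv (ha : SymbolSmoothOn U a) (hU : IsOpen U)
    (Lx : List (Fin n)) (Lθ : List (Fin N)) : SymbolSmoothOn U (symbolDeriv Lx Lθ a) := by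
  induction Lx with
  | nil => exact ha.foldr_pdTheta hU Lθ
  | cons i L ih => exact ih.pdX hU i

lemma SymbolSmoothOn.add (ha : SymbolSmoothOn U a) (hb : SymbolSmoothOn U b) :
    SymbolSmoothOn U (fun x θ => a x θ + b x θ) :=
  ContDiffOn.add ha hb

lemma SymbolSmoothOn.neg (ha : SymbolSmoothOn U a) :
    SymbolSmoothOn U (fun x θ => - a x θ) :=
  ContDiffOn.neg ha

lemma SymbolSmoothOn.sub (ha : SymbolSmoothOn U a) (hb : SymbolSmoothOn U b) :
    SymbolSmoothOn U (fun x θ => a x θ - b x θ) :=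
  ContDiffOn.sub ha hb

lemma SymbolSmoothOn.mul (ha : SymbolSmoothOn U a) (hb : SymbolSmoothOn U b) :
    SymbolSmoothOn U (fun x θ => a x θ * b x θ) :=
  ContDiffOn.mul ha hb

lemma ContDiff.symbolSmoothOn {c : (Fin N → ℝ) → ℂ} (hc : ContDiff ℝ (⊤ : ℕ∞) c) :
    SymbolSmoothOn U (fun _ => c) :=
  (hc.comp contDiff_snd).contDiffOn

lemma pdX_congr (hU : IsOpen U) (h : ∀ x θ, (x, θ) ∈ U → a x θ = b x θ) (i : Fin n)
    (x : Fin n → ℝ) (θ : Fin N → ℝ) (hx : (x, θ) ∈ U) : pdX i a x θ = pdX i b x θ := by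
  have : (fun x' => a x' θ) =ᶠ[nhds x] fun x' => b x' θ := by
    have h1 : Tendsto (fun x' => (x', θ)) (nhds x) (nhds (x, θ)) :=
      (Continuous.prodMk_left θ).continuousAt
    exact mem_of_superset (h1 (hU.mem_nhds hx)) fun x' hx' => h _ _ hx'
  rw [pdX, pdX, this.fderiv_eq]

lemma pdTheta_congr (hU : IsOpen U) (h : ∀ x θ, (x, θ) ∈ U → a x θ = b x θ) (i : Fin N)
    (x : Fin n → ℝ) (θ : Fin N → ℝ) (hx : (x, θ) ∈ U) :
    pdTheta i a x θ = pdTheta i b x θ := by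
  have : (fun θ' => a x θ') =ᶠ[nhds θ] fun θ' => b x θ' := by
    have h1 : Tendsto (fun θ' => (x, θ')) (nhds θ) (nhds (x, θ)) :=
      (Continuous.prodMk_right x).continuousAt
    exact mem_of_superset (h1 (hU.mem_nhds hx)) fun x' hx' => h _ _ hx'
  rw [pdTheta, pdTheta, this.fderiv_eq]

lemma symbolDeriv_congr (hU : IsOpen U) (h : ∀ x θ, (x, θ) ∈ U → a x θ = b x θ)
    (Lx : List (Fin n)) (Lθ : List (Fin N)) :
    ∀ x θ, (x, θ) ∈ U → symbolDeriv Lx Lθ a x θ = symbolDeriv Lx Lθ b x θ := by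
  induction Lx with
  | nil =>
    induction Lθ with
    | nil => exact h
    | cons i L ih => exact pdTheta_congr hU ih i
  | cons i L ih => exact pdX_congr hU ih i

lemma symbolDeriv_zero (Lx : List (Fin n)) (Lθ : List (Fin N)) :
    symbolDeriv Lx Lθ (fun _ _ => 0) = fun _ _ => 0 := by
  induction Lx with
  | nil =>
    induction Lθ with
    | nil => rfl
    | cons i L ih =>
      change pdTheta i (symbolDeriv [] L _) = _
      rw [ih]
      funext x θ
      simp [pdTheta]
  | cons i L ih =>
    change pdX i (symbolDeriv L Lθ _) = _
    rw [ih]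
    funext x θ
    simp [pdX]

lemma symbolDeriv_add (hU : IsOpen U) (ha : SymbolSmoothOn U a) (hb : SymbolSmoothOn U b)
    (Lx : List (Fin n)) (Lθ : List (Fin N)) :
    ∀ x θ, (x, θ) ∈ U → symbolDeriv Lx Lθ (fun x θ => a x θ + b x θ) x θ =
      symbolDeriv Lx Lθ a x θ + symbolDeriv Lx Lθ b x θ := by
  induction Lx with
  | nil =>
    induction Lθ with
    | nil => exact fun _ _ _ => rfl
    | cons i L ih =>
      intro x θ h
      refine (pdTheta_congr hU ih i x θ h).trans ?_
      have h1 := (ha.symbolDeriv hU [] L).hasFDerivAt_right hU h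
      have h2 := (hb.symbolDeriv hU [] L).hasFDerivAt_right hU h
      change fderiv ℝ _ _ _ = fderiv ℝ (fun θ' => symbolDeriv [] L a x θ') θ _ +
        fderiv ℝ (fun θ' => symbolDeriv [] L b x θ') θ _
      rw [(h1.fun_add h2).fderiv, h1.fderiv, h2.fderiv]
      rfl
  | cons i L ih =>
    intro x θ h
    refine (pdX_congr hU ih i x θ h).trans ?_
    have h1 := (ha.symbolDeriv hU L Lθ).hasFDerivAt_left hU h
    have h2 := (hb.symbolDeriv hU L Lθ).hasFDerivAt_left hU h
    change fderiv ℝ _ _ _ = fderiv ℝ (fun x' => symbolDeriv L Lθ a x' θ) x _ +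
      fderiv ℝ (fun x' => symbolDeriv L Lθ b x' θ) x _
    rw [(h1.fun_add h2).fderiv, h1.fderiv, h2.fderiv]
    rfl

lemma symbolDeriv_neg (a : (Fin n → ℝ) → (Fin N → ℝ) → ℂ)
    (Lx : List (Fin n)) (Lθ : List (Fin N)) :
    symbolDeriv Lx Lθ (fun x θ => - a x θ) = fun x θ => - symbolDeriv Lx Lθ a x θ := by
  induction Lx with
  | nil =>
    induction Lθ with
    | nil => rfl
    | cons i L ih =>
      change pdTheta i (symbolDeriv [] L _) = fun x θ => - pdTheta i (symbolDeriv [] L a) x θ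
      rw [ih]
      funext x θ
      simp [pdTheta]
  | cons i L ih =>
    change pdX i (symbolDeriv L Lθ _) = fun x θ => - pdX i (symbolDeriv L Lθ a) x θ
    rw [ih]
    funext x θ
    simp [pdX]

lemma symbolDeriv_sub (hU : IsOpen U) (ha : SymbolSmoothOn U a) (hb : SymbolSmoothOn U b)
    (Lx : List (Fin n)) (Lθ : List (Fin N)) (x : Fin n → ℝ) (θ : Fin N → ℝ)
    (h : (x, θ) ∈ U) :
    symbolDeriv Lx Lθ (fun x θ => a x θ - b x θ) x θ =
      symbolDeriv Lx Lθ a x θ - symbolDeriv Lx Lθ b x θ := by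
  simp only [sub_eq_add_neg]
  rw [symbolDeriv_add hU ha hb.neg Lx Lθ x θ h, symbolDeriv_neg]

lemma SymbolSmoothOn.sum {ι : Type*} {s : Finset ι} {f : ι → (Fin n → ℝ) → (Fin N → ℝ) → ℂ}
    (hf : ∀ j ∈ s, SymbolSmoothOn U (f j)) : SymbolSmoothOn U (fun x θ => ∑ j ∈ s, f j x θ) :=
  ContDiffOn.sum hf

lemma symbolDeriv_sum (hU : IsOpen U) {ι : Type*} (s : Finset ι)
    {f : ι → (Fin n → ℝ) → (Fin N → ℝ) → ℂ} (hf : ∀ j, SymbolSmoothOn U (f j))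
    (Lx : List (Fin n)) (Lθ : List (Fin N)) (x : Fin n → ℝ) (θ : Fin N → ℝ)
    (h : (x, θ) ∈ U) :
    symbolDeriv Lx Lθ (fun x θ => ∑ j ∈ s, f j x θ) x θ =
      ∑ j ∈ s, symbolDeriv Lx Lθ (f j) x θ := by
  classical
  induction s using Finset.induction_on with
  | empty => simp [symbolDeriv_zero]
  | insert j s hj ih =>
    simp only [Finset.sum_insert hj]
    rw [symbolDeriv_add hU (hf j) (SymbolSmoothOn.sum fun i _ => hf i) Lx Lθ x θ h, ih]

lemma symbolDeriv_append_singleton (Lx : List (Fin n)) (Lθ : List (Fin N)) (i : Fin N)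
    (a : (Fin n → ℝ) → (Fin N → ℝ) → ℂ) :
    symbolDeriv Lx (Lθ ++ [i]) a = symbolDeriv Lx Lθ (pdTheta i a) := by
  simp [symbolDeriv]

lemma thetaDeriv_append_singleton (L : List (Fin N)) (i : Fin N) (c : (Fin N → ℝ) → ℂ) :
    thetaDeriv (L ++ [i]) c = thetaDeriv L (thetaDeriv [i] c) := by
  simp [thetaDeriv]

lemma contDiff_thetaDeriv {c : (Fin N → ℝ) → ℂ} (hc : ContDiff ℝ (⊤ : ℕ∞) c)
    (L : List (Fin N)) : ContDiff ℝ (⊤ : ℕ∞) (thetaDeriv L c) := by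
  induction L with
  | nil => exact hc
  | cons i L ih => exact (ih.fderiv_right (by simp)).clm_apply contDiff_const

lemma thetaDeriv_comp_smul (c : (Fin N → ℝ) → ℂ) (r : ℝ) (L : List (Fin N)) :
    thetaDeriv L (fun θ => c (r • θ)) =
      fun θ => (r : ℂ) ^ L.length * thetaDeriv L c (r • θ) := by
  induction L with
  | nil => simp [thetaDeriv]
  | cons i L ih =>
    funext θ
    change fderiv ℝ (thetaDeriv L fun θ => c (r • θ)) θ _ =
      _ * fderiv ℝ (thetaDeriv L c) (r • θ) _
    rw [ih]
    have h := fderiv_const_smul_field (𝕜 := ℝ) (f := fun θ => thetaDeriv L c (r • θ))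
      ((r : ℂ) ^ L.length)
    have h' := congrFun h θ
    rw [Pi.smul_apply, fderiv_comp_smul] at h'
    refine (DFunLike.congr_fun h' _).trans ?_
    simp [pow_succ, mul_assoc]

lemma thetaDeriv_eq_zero_of_lt {c : (Fin N → ℝ) → ℂ} {R : ℝ}
    (hc : ∀ θ, R < ‖θ‖ → c θ = 0) (L : List (Fin N)) :
    ∀ θ, R < ‖θ‖ → thetaDeriv L c θ = 0 := by
  induction L with
  | nil => exact hc
  | cons i L ih =>
    intro θ hθ
    have : thetaDeriv L c =ᶠ[nhds θ] fun _ => 0 :=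
      mem_of_superset ((isOpen_lt continuous_const continuous_norm).mem_nhds hθ)
        fun θ' h => ih θ' h
    change fderiv ℝ (thetaDeriv L c) θ _ = 0
    rw [this.fderiv_eq]
    simp

lemma symbolDeriv_nil_mul (c : (Fin N → ℝ) → ℂ) (a : (Fin n → ℝ) → (Fin N → ℝ) → ℂ)
    (Lx : List (Fin n)) :
    symbolDeriv Lx [] (fun x θ => c θ * a x θ) = fun x θ => c θ * symbolDeriv Lx [] a x θ := by
  induction Lx with
  | nil => rfl
  | cons i L ih =>
    change pdX i (symbolDeriv L [] _) = fun x θ => c θ * pdX i (symbolDeriv L [] a) x θ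
    rw [ih]
    funext x θ
    have h := congrFun (fderiv_const_smul_field (𝕜 := ℝ)
      (f := fun x => symbolDeriv L [] a x θ) (c θ)) x
    exact DFunLike.congr_fun h _

lemma pdTheta_mul (hU : IsOpen U) {c : (Fin N → ℝ) → ℂ} (hc : ContDiff ℝ (⊤ : ℕ∞) c)
    (ha : SymbolSmoothOn U a) (i : Fin N) (x : Fin n → ℝ) (θ : Fin N → ℝ) (h : (x, θ) ∈ U) :
    pdTheta i (fun x θ => c θ * a x θ) x θ =
      thetaDeriv [i] c θ * a x θ + c θ * pdTheta i a x θ := by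
  have h1 : HasFDerivAt c (fderiv ℝ c θ) θ :=
    ((hc.differentiable (by simp)) θ).hasFDerivAt
  have h2 := ha.hasFDerivAt_right hU h
  change fderiv ℝ (fun θ' => c θ' * a x θ') θ _ = fderiv ℝ c θ _ * a x θ +
    c θ * fderiv ℝ (fun θ' => a x θ') θ _
  rw [(h1.fun_mul h2).fderiv, h2.fderiv]
  simp
  ring

lemma norm_symbolDeriv_mul_le (hU : IsOpen U) {ρ : ℝ} {Lx : List (Fin n)} {x : Fin n → ℝ}
    {θ : Fin N → ℝ} (h : (x, θ) ∈ U) (Lθ : List (Fin N)) :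
    ∀ (c : (Fin N → ℝ) → ℂ) (a : (Fin n → ℝ) → (Fin N → ℝ) → ℂ) (s q C A : ℝ),
      ContDiff ℝ (⊤ : ℕ∞) c → SymbolSmoothOn U a →
      (∀ L : List (Fin N), L.length ≤ Lθ.length →
        ‖thetaDeriv L c θ‖ ≤ C * jweight (s - ρ * L.length) θ) →
      (∀ L : List (Fin N), L.length ≤ Lθ.length →
        ‖symbolDeriv Lx L a x θ‖ ≤ A * jweight (q - ρ * L.length) θ) →
      ‖symbolDeriv Lx Lθ (fun x θ => c θ * a x θ) x θ‖ ≤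
        2 ^ Lθ.length * (C * A) * jweight (s + q - ρ * Lθ.length) θ := by
  induction Lθ using List.reverseRecOn with
  | nil =>
    intro c a s q C A hc ha hC hA
    have h1 := hC [] le_rfl
    have h2 := hA [] le_rfl
    rw [symbolDeriv_nil_mul, norm_mul]
    simp only [List.length_nil, Nat.cast_zero, mul_zero, sub_zero, pow_zero, one_mul] at h1 h2 ⊢
    rw [jweight_add]
    calc _ ≤ (C * jweight s θ) * (A * jweight q θ) :=
          mul_le_mul h1 h2 (norm_nonneg _) ((norm_nonneg _).trans h1)
      _ = _ := by ring
  | append_singleton Lθ i ih =>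
    intro c a s q C A hc ha hC hA
    have hlen : (Lθ ++ [i]).length = Lθ.length + 1 := by simp
    rw [hlen] at hC hA
    rw [symbolDeriv_append_singleton,
      symbolDeriv_congr hU (pdTheta_mul hU hc ha i) Lx Lθ x θ h,
      symbolDeriv_add hU ((contDiff_thetaDeriv hc [i]).symbolSmoothOn.mul ha)
        (hc.symbolSmoothOn.mul (ha.pdTheta hU i)) Lx Lθ x θ h]
    have e1 := ih (thetaDeriv [i] c) a (s - ρ) q C A (contDiff_thetaDeriv hc [i]) ha
      (fun L hL => by
        have := hC (L ++ [i]) (by simpa using hL)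
        rw [thetaDeriv_append_singleton] at this
        convert this using 3
        push_cast [List.length_append, List.length_singleton]
        ring)
      (fun L hL => hA L (by omega))
    have e2 := ih c (pdTheta i a) s (q - ρ) C A hc (ha.pdTheta hU i)
      (fun L hL => hC L (by omega))
      (fun L hL => by
        have := hA (L ++ [i]) (by simpa using hL)
        rw [symbolDeriv_append_singleton] at this
        convert this using 3
        push_cast [List.length_append, List.length_singleton]
        ring)
    refine (norm_add_le _ _).trans ((add_le_add e1 e2).trans (le_of_eq ?_))
    have w1 : s - ρ + q - ρ * Lθ.length = s + q - ρ * (Lθ ++ [i]).length := by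
      rw [hlen]; push_cast; ring
    have w2 : s + (q - ρ) - ρ * Lθ.length = s + q - ρ * (Lθ ++ [i]).length := by
      rw [hlen]; push_cast; ring
    rw [w1, w2, hlen]
    ring

end Calculus

lemma exists_uniform_of_length_le {ι : Type*} [Finite ι] {P : List ι → ℝ → Prop}
    (hmono : ∀ L C C', C ≤ C' → P L C → P L C') (h : ∀ L, ∃ C, P L C) (l : ℕ) :
    ∃ C, 0 ≤ C ∧ ∀ L : List ι, L.length ≤ l → P L C := by
  choose B hB using h
  obtain ⟨M, hM⟩ := ((List.finite_length_le ι l).image B).bddAbove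
  exact ⟨max M 0, le_max_right _ _, fun L hL =>
    hmono L _ _ ((hM ⟨L, hL, rfl⟩).trans (le_max_left _ _)) (hB L)⟩

section Cutoff

variable {N : ℕ}

lemma exists_norm_thetaDeriv_le_of_eq_zero {c : (Fin N → ℝ) → ℂ}
    (hc : ContDiff ℝ (⊤ : ℕ∞) c) {R : ℝ} (h0 : ∀ θ, R < ‖θ‖ → c θ = 0) (s : ℝ)
    (L : List (Fin N)) : ∃ C, ∀ θ, ‖thetaDeriv L c θ‖ ≤ C * jweight s θ := by
  have hcont : Continuous fun θ => ‖thetaDeriv L c θ‖ / jweight s θ :=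
    (contDiff_thetaDeriv hc L).continuous.norm.div (continuous_jweight s)
      fun θ => (jweight_pos s θ).ne'
  obtain ⟨M, hM⟩ :=
    ((isCompact_closedBall (0 : Fin N → ℝ) R).image hcont).bddAbove
  refine ⟨max M 0, fun θ => ?_⟩
  rcases lt_or_ge R ‖θ‖ with h | h
  · rw [thetaDeriv_eq_zero_of_lt h0 L θ h, norm_zero]
    exact mul_nonneg (le_max_right _ _) (jweight_pos s θ).le
  · rw [← div_le_iff₀ (jweight_pos s θ)]
    exact (hM ⟨θ, by simpa using h, rfl⟩).trans (le_max_left _ _)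

/-- Dilations of a bump function form a bounded set of symbols of order `0`. -/
lemma exists_uniform_bump {ρ : ℝ} (hρ1 : ρ ≤ 1) :
    ∃ b : ℝ → (Fin N → ℝ) → ℂ, (∀ R, ContDiff ℝ (⊤ : ℕ∞) (b R)) ∧
      (∀ R, 1 ≤ R → ∀ θ, ‖θ‖ < R → b R θ = 1) ∧
      (∀ R, 1 ≤ R → ∀ θ, 2 * R < ‖θ‖ → b R θ = 0) ∧
      ∀ L : List (Fin N), ∃ C, ∀ R, 1 ≤ R → ∀ θ,
        ‖thetaDeriv L (b R) θ‖ ≤ C * jweight (0 - ρ * L.length) θ := by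
  let f : ContDiffBump (0 : Fin N → ℝ) := ⟨1, 2, one_pos, one_lt_two⟩
  let η : (Fin N → ℝ) → ℂ := fun θ => (f θ : ℂ)
  have hη : ContDiff ℝ (⊤ : ℕ∞) η := Complex.ofRealCLM.contDiff.comp f.contDiff
  have hη0 : ∀ θ, 2 < ‖θ‖ → η θ = 0 := fun θ h => by
    have : f θ = 0 := f.zero_of_le_dist (by simpa using h.le)
    simp [η, this]
  have hscale : ∀ R : ℝ, 1 ≤ R → ∀ θ : Fin N → ℝ, ‖R⁻¹ • θ‖ = R⁻¹ * ‖θ‖ := fun R hR θ => by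
    rw [norm_smul, Real.norm_of_nonneg (by positivity)]
  refine ⟨fun R θ => η (R⁻¹ • θ), fun R => hη.comp (contDiff_const_smul _), ?_, ?_, ?_⟩
  · intro R hR θ hθ
    have : f (R⁻¹ • θ) = 1 := f.one_of_mem_closedBall (by
      rw [mem_closedBall_zero_iff, hscale R hR]
      change _ ≤ (1 : ℝ)
      rw [inv_mul_le_iff₀ (by linarith)]
      linarith)
    simp [η, this]
  · intro R hR θ hθ
    refine hη0 _ ?_
    rw [hscale R hR, lt_inv_mul_iff₀ (by linarith)]
    linarith
  · intro L
    obtain ⟨M, hM⟩ := exists_norm_thetaDeriv_le_of_eq_zero hη hη0 0 L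
    simp only [jweight_zero, mul_one] at hM
    have hM0 : 0 ≤ M := (norm_nonneg _).trans (hM 0)
    refine ⟨M * 3 ^ L.length, fun R hR θ => ?_⟩
    have hR0 : 0 < R := by linarith
    simp only [thetaDeriv_comp_smul]
    rcases lt_or_ge (2 * R) ‖θ‖ with h | h
    · rw [thetaDeriv_eq_zero_of_lt hη0 L _ (by
        rw [hscale R hR, lt_inv_mul_iff₀ hR0]; linarith)]
      simp only [mul_zero, norm_zero]
      exact mul_nonneg (by positivity) (jweight_pos _ θ).le
    · have hw : jweight 1 θ ≤ 3 * R := by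
        rw [jweight, ← Real.sqrt_eq_rpow]
        refine Real.sqrt_le_iff.2 ⟨by positivity, ?_⟩
        nlinarith [norm_nonneg θ]
      have hprod : jweight (0 - ρ * L.length) θ * (3 * R) ^ L.length ≥ 1 := by
        calc jweight (0 - ρ * L.length) θ * (3 * R) ^ L.length
            ≥ jweight (-(L.length : ℝ)) θ * jweight 1 θ ^ L.length := by
              have h1 : jweight (-(L.length : ℝ)) θ ≤ jweight (0 - ρ * L.length) θ :=
                jweight_mono (by nlinarith [(Nat.cast_nonneg L.length : (0 : ℝ) ≤ _)]) θ
              exact mul_le_mul h1 (pow_le_pow_left₀ (jweight_pos 1 θ).le hw _)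
                (pow_nonneg (jweight_pos 1 θ).le _) (jweight_pos _ θ).le
          _ = 1 := by
              rw [← jweight_natCast, ← jweight_add, neg_add_cancel, jweight_zero]
      rw [norm_mul, norm_pow, Complex.norm_real, Real.norm_of_nonneg (by positivity), inv_pow,
        inv_mul_le_iff₀ (by positivity)]
      calc ‖thetaDeriv L η (R⁻¹ • θ)‖ ≤ M * 1 := by simpa using hM _
        _ ≤ M * (jweight (0 - ρ * L.length) θ * (3 * R) ^ L.length) :=
          mul_le_mul_of_nonneg_left hprod hM0
        _ = _ := by rw [mul_pow]; ring

end Cutoff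

section Families

variable {T : Type*} [TopologicalSpace T] {n N : ℕ} {ρ δ m : ℝ} {W : Set (Fin n → ℝ)}
  {a b : T → (Fin n → ℝ) → (Fin N → ℝ) → ℂ}

lemma IsContinuousSymbolFamily.smooth (ha : IsContinuousSymbolFamily ρ δ m W a) (t : T) :
    SymbolSmoothOn (W ×ˢ Set.univ) (a t) :=
  (ha.1 t).1

lemma IsContinuousSymbolFamily.mono {m' : ℝ} (h : m ≤ m')
    (ha : IsContinuousSymbolFamily ρ δ m W a) : IsContinuousSymbolFamily ρ δ m' W a := by
  refine ⟨fun t => ⟨ha.smooth t, fun K hKW hK Lx Lθ => ?_⟩, fun t₀ K hKW hK Lx Lθ ε hε => ?_⟩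
  · obtain ⟨C, hC0, hC⟩ := (ha.1 t).2 K hKW hK Lx Lθ
    exact ⟨C, hC0, fun x hx θ => (hC x hx θ).trans
      (mul_le_mul_of_nonneg_left (jweight_mono (by linarith) θ) hC0)⟩
  · filter_upwards [ha.2 t₀ K hKW hK Lx Lθ ε hε] with t ht x hx θ
    exact (ht x hx θ).trans (mul_le_mul_of_nonneg_left (jweight_mono (by linarith) θ) hε.le)

lemma IsContinuousSymbolFamily.zero :
    IsContinuousSymbolFamily ρ δ m W (fun (_ : T) _ (_ : Fin N → ℝ) => 0) := by
  refine ⟨fun t => ⟨contDiffOn_const, fun K hKW hK Lx Lθ => ⟨0, le_rfl, fun x hx θ => ?_⟩⟩,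
    fun t₀ K hKW hK Lx Lθ ε hε => .of_forall fun t x hx θ => ?_⟩
  · simp [symbolDeriv_zero]
  · simp only [sub_zero, symbolDeriv_zero, norm_zero]
    exact mul_nonneg hε.le (jweight_pos _ θ).le

lemma IsContinuousSymbolFamily.neg (ha : IsContinuousSymbolFamily ρ δ m W a) :
    IsContinuousSymbolFamily ρ δ m W (fun t x θ => - a t x θ) := by
  refine ⟨fun t => ⟨(ha.smooth t).neg, fun K hKW hK Lx Lθ => ?_⟩,
    fun t₀ K hKW hK Lx Lθ ε hε => ?_⟩
  · simpa only [symbolDeriv_neg, norm_neg] using (ha.1 t).2 K hKW hK Lx Lθ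
  · filter_upwards [ha.2 t₀ K hKW hK Lx Lθ ε hε] with t ht x hx θ
    have e : (fun x' θ' => - a t x' θ' - - a t₀ x' θ') =
        fun x' θ' => - (a t x' θ' - a t₀ x' θ') := by
      funext x' θ'
      ring
    simpa only [e, symbolDeriv_neg, norm_neg] using ht x hx θ

lemma IsContinuousSymbolFamily.add (hW : IsOpen W) (ha : IsContinuousSymbolFamily ρ δ m W a)
    (hb : IsContinuousSymbolFamily ρ δ m W b) :
    IsContinuousSymbolFamily ρ δ m W (fun t x θ => a t x θ + b t x θ) := by
  have hU : IsOpen (W ×ˢ (Set.univ : Set (Fin N → ℝ))) := hW.prod isOpen_univ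
  refine ⟨fun t => ⟨(ha.smooth t).add (hb.smooth t), fun K hKW hK Lx Lθ => ?_⟩,
    fun t₀ K hKW hK Lx Lθ ε hε => ?_⟩
  · obtain ⟨C, hC0, hC⟩ := (ha.1 t).2 K hKW hK Lx Lθ
    obtain ⟨D, hD0, hD⟩ := (hb.1 t).2 K hKW hK Lx Lθ
    refine ⟨C + D, add_nonneg hC0 hD0, fun x hx θ => ?_⟩
    rw [symbolDeriv_add hU (ha.smooth t) (hb.smooth t) Lx Lθ x θ ⟨hKW hx, trivial⟩, add_mul]
    exact (norm_add_le _ _).trans (add_le_add (hC x hx θ) (hD x hx θ))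
  · filter_upwards [ha.2 t₀ K hKW hK Lx Lθ (ε / 2) (by positivity),
      hb.2 t₀ K hKW hK Lx Lθ (ε / 2) (by positivity)] with t ht ht' x hx θ
    have e : (fun x' θ' => a t x' θ' + b t x' θ' - (a t₀ x' θ' + b t₀ x' θ')) =
        fun x' θ' => (a t x' θ' - a t₀ x' θ') + (b t x' θ' - b t₀ x' θ') := by
      funext x' θ'
      ring
    rw [e, symbolDeriv_add hU ((ha.smooth t).sub (ha.smooth t₀))
      ((hb.smooth t).sub (hb.smooth t₀)) Lx Lθ x θ ⟨hKW hx, trivial⟩]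
    refine (norm_add_le _ _).trans ((add_le_add (ht x hx θ) (ht' x hx θ)).trans (le_of_eq ?_))
    ring

lemma IsContinuousSymbolFamily.sub (hW : IsOpen W) (ha : IsContinuousSymbolFamily ρ δ m W a)
    (hb : IsContinuousSymbolFamily ρ δ m W b) :
    IsContinuousSymbolFamily ρ δ m W (fun t x θ => a t x θ - b t x θ) := by
  simpa only [sub_eq_add_neg] using ha.add hW hb.neg

lemma IsContinuousSymbolFamily.sum (hW : IsOpen W) {ι : Type*} (s : Finset ι)
    {f : ι → T → (Fin n → ℝ) → (Fin N → ℝ) → ℂ}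
    (hf : ∀ j, IsContinuousSymbolFamily ρ δ m W (f j)) :
    IsContinuousSymbolFamily ρ δ m W (fun t x θ => ∑ j ∈ s, f j t x θ) := by
  classical
  induction s using Finset.induction_on with
  | empty => simpa using IsContinuousSymbolFamily.zero
  | insert j s hj ih =>
    simp only [Finset.sum_insert hj]
    exact (hf j).add hW ih

/-- A family that is locally uniformly approximated by continuous families is continuous. -/
lemma IsContinuousSymbolFamily.of_approx (hW : IsOpen W)
    (hsm : ∀ t, SymbolSmoothOn (W ×ˢ Set.univ) (a t))
    (h : ∀ t₀ : T, ∀ K ⊆ W, IsCompact K → ∀ (Lx : List (Fin n)) (Lθ : List (Fin N)),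
      ∀ ε : ℝ, 0 < ε → ∃ p : T → (Fin n → ℝ) → (Fin N → ℝ) → ℂ,
        IsContinuousSymbolFamily ρ δ m W p ∧ ∀ᶠ t in nhds t₀, ∀ x ∈ K, ∀ θ : Fin N → ℝ,
          ‖symbolDeriv Lx Lθ (fun x' θ' => a t x' θ' - p t x' θ') x θ‖ ≤
            ε * jweight (m - ρ * Lθ.length + δ * Lx.length) θ) :
    IsContinuousSymbolFamily ρ δ m W a := by
  have hU : IsOpen (W ×ˢ (Set.univ : Set (Fin N → ℝ))) := hW.prod isOpen_univ
  refine ⟨fun t => ⟨hsm t, fun K hKW hK Lx Lθ => ?_⟩, fun t₀ K hKW hK Lx Lθ ε hε => ?_⟩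
  · obtain ⟨p, hp, hap⟩ := h t K hKW hK Lx Lθ 1 one_pos
    obtain ⟨C, hC0, hC⟩ := (hp.1 t).2 K hKW hK Lx Lθ
    refine ⟨1 + C, by positivity, fun x hx θ => ?_⟩
    have h1 := hap.self_of_nhds x hx θ
    rw [symbolDeriv_sub hU (hsm t) (hp.smooth t) Lx Lθ x θ ⟨hKW hx, trivial⟩] at h1
    have h2 := norm_add_le (symbolDeriv Lx Lθ (a t) x θ - symbolDeriv Lx Lθ (p t) x θ)
      (symbolDeriv Lx Lθ (p t) x θ)
    rw [sub_add_cancel] at h2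
    have h3 := hC x hx θ
    linarith
  · obtain ⟨p, hp, hap⟩ := h t₀ K hKW hK Lx Lθ (ε / 3) (by positivity)
    filter_upwards [hap, hp.2 t₀ K hKW hK Lx Lθ (ε / 3) (by positivity)] with t ht ht' x hx θ
    have hxU : (x, θ) ∈ W ×ˢ (Set.univ : Set (Fin N → ℝ)) := ⟨hKW hx, trivial⟩
    have h1 := ht x hx θ
    have h2 := hap.self_of_nhds x hx θ
    have h3 := ht' x hx θ
    rw [symbolDeriv_sub hU (hsm _) (hp.smooth _) Lx Lθ x θ hxU] at h1 h2
    rw [symbolDeriv_sub hU (hp.smooth _) (hp.smooth _) Lx Lθ x θ hxU] at h3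
    rw [symbolDeriv_sub hU (hsm _) (hsm _) Lx Lθ x θ hxU]
    have e : symbolDeriv Lx Lθ (a t) x θ - symbolDeriv Lx Lθ (a t₀) x θ =
        (symbolDeriv Lx Lθ (a t) x θ - symbolDeriv Lx Lθ (p t) x θ) +
        (symbolDeriv Lx Lθ (p t) x θ - symbolDeriv Lx Lθ (p t₀) x θ) -
        (symbolDeriv Lx Lθ (a t₀) x θ - symbolDeriv Lx Lθ (p t₀) x θ) := by ring
    rw [e]
    refine (norm_sub_le _ _).trans ?_
    have h4 := norm_add_le (symbolDeriv Lx Lθ (a t) x θ - symbolDeriv Lx Lθ (p t) x θ)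
      (symbolDeriv Lx Lθ (p t) x θ - symbolDeriv Lx Lθ (p t₀) x θ)
    linarith

/-- The seminorms of a continuous family are bounded over compact parameter sets. -/
lemma IsContinuousSymbolFamily.exists_bound_of_isCompact (hW : IsOpen W)
    (ha : IsContinuousSymbolFamily ρ δ m W a) {Q : Set T} (hQ : IsCompact Q)
    {K : Set (Fin n → ℝ)} (hKW : K ⊆ W) (hK : IsCompact K)
    (Lx : List (Fin n)) (Lθ : List (Fin N)) :
    ∃ C, ∀ t ∈ Q, ∀ x ∈ K, ∀ θ, ‖symbolDeriv Lx Lθ (a t) x θ‖ ≤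
      C * jweight (m - ρ * Lθ.length + δ * Lx.length) θ := by
  have hU : IsOpen (W ×ˢ (Set.univ : Set (Fin N → ℝ))) := hW.prod isOpen_univ
  refine hQ.induction_on ⟨0, by simp⟩ (fun s t hst ⟨C, hC⟩ => ⟨C, fun t ht => hC t (hst ht)⟩)
    ?_ fun t₀ _ => ?_
  · rintro s s' ⟨C, hC⟩ ⟨D, hD⟩
    refine ⟨max C D, ?_⟩
    rintro t (ht | ht) x hx θ
    · exact (hC t ht x hx θ).trans
        (mul_le_mul_of_nonneg_right (le_max_left _ _) (jweight_pos _ θ).le)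
    · exact (hD t ht x hx θ).trans
        (mul_le_mul_of_nonneg_right (le_max_right _ _) (jweight_pos _ θ).le)
  · obtain ⟨C, hC0, hC⟩ := (ha.1 t₀).2 K hKW hK Lx Lθ
    refine ⟨_, mem_nhdsWithin_of_mem_nhds (ha.2 t₀ K hKW hK Lx Lθ 1 one_pos), 1 + C, ?_⟩
    intro t ht x hx θ
    have h1 := ht x hx θ
    rw [symbolDeriv_sub hU (ha.smooth t) (ha.smooth t₀) Lx Lθ x θ ⟨hKW hx, trivial⟩] at h1
    have h2 := norm_add_le (symbolDeriv Lx Lθ (a t) x θ - symbolDeriv Lx Lθ (a t₀) x θ)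
      (symbolDeriv Lx Lθ (a t₀) x θ)
    rw [sub_add_cancel] at h2
    have h3 := hC x hx θ
    linarith

lemma norm_symbolDeriv_cutoff_le (hW : IsOpen W) {c : (Fin N → ℝ) → ℂ}
    {f : (Fin n → ℝ) → (Fin N → ℝ) → ℂ} {s C A : ℝ} (hc : ContDiff ℝ (⊤ : ℕ∞) c)
    (hf : SymbolSmoothOn (W ×ˢ Set.univ) f) {x : Fin n → ℝ} (hx : x ∈ W) {θ : Fin N → ℝ}
    {Lx : List (Fin n)} {Lθ : List (Fin N)}
    (hC : ∀ L : List (Fin N), L.length ≤ Lθ.length →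
      ‖thetaDeriv L c θ‖ ≤ C * jweight (s - ρ * L.length) θ)
    (hA : ∀ L : List (Fin N), L.length ≤ Lθ.length →
      ‖symbolDeriv Lx L f x θ‖ ≤ A * jweight (m - ρ * L.length + δ * Lx.length) θ) :
    ‖symbolDeriv Lx Lθ (fun x θ => c θ * f x θ) x θ‖ ≤
      2 ^ Lθ.length * (C * A) * jweight (s + m - ρ * Lθ.length + δ * Lx.length) θ := by
  have h := norm_symbolDeriv_mul_le (hW.prod isOpen_univ) (ρ := ρ) (Lx := Lx)
    (show (x, θ) ∈ W ×ˢ Set.univ from ⟨hx, trivial⟩) Lθ c f s (m + δ * Lx.length) C A hc hf hC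
    (fun L hL => by convert hA L hL using 3; ring)
  convert h using 3
  ring

lemma IsContinuousSymbolFamily.cutoff_mul (hW : IsOpen W) {c : (Fin N → ℝ) → ℂ} {s : ℝ}
    (hc : ContDiff ℝ (⊤ : ℕ∞) c)
    (hcs : ∀ L : List (Fin N), ∃ C, ∀ θ, ‖thetaDeriv L c θ‖ ≤ C * jweight (s - ρ * L.length) θ)
    (ha : IsContinuousSymbolFamily ρ δ m W a) :
    IsContinuousSymbolFamily ρ δ (s + m) W (fun t x θ => c θ * a t x θ) := by
  have hU : IsOpen (W ×ˢ (Set.univ : Set (Fin N → ℝ))) := hW.prod isOpen_univ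
  have hcl := exists_uniform_of_length_le (P := fun L C => ∀ θ, ‖thetaDeriv L c θ‖ ≤
    C * jweight (s - ρ * L.length) θ) (fun L C C' hCC h θ => (h θ).trans
      (mul_le_mul_of_nonneg_right hCC (jweight_pos _ θ).le)) hcs
  refine ⟨fun t => ⟨SymbolSmoothOn.mul hc.symbolSmoothOn (ha.smooth t),
    fun K hKW hK Lx Lθ => ?_⟩, fun t₀ K hKW hK Lx Lθ ε hε => ?_⟩
  · obtain ⟨C, hC0, hC⟩ := hcl Lθ.length
    obtain ⟨A, hA0, hA⟩ := exists_uniform_of_length_le (P := fun L A => ∀ x ∈ K, ∀ θ,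
      ‖symbolDeriv Lx L (a t) x θ‖ ≤ A * jweight (m - ρ * L.length + δ * Lx.length) θ)
      (fun L C C' hCC h x hx θ => (h x hx θ).trans
      (mul_le_mul_of_nonneg_right hCC (jweight_pos _ θ).le))
      (fun L => ((ha.1 t).2 K hKW hK Lx L).imp fun _ h => h.2) Lθ.length
    exact ⟨2 ^ Lθ.length * (C * A), by positivity, fun x hx θ =>
      norm_symbolDeriv_cutoff_le hW hc (ha.smooth t) (hKW hx) (fun L hL => hC L hL θ)
        fun L hL => hA L hL x hx θ⟩
  · obtain ⟨C, hC0, hC⟩ := hcl Lθ.length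
    have hev : ∀ᶠ t in nhds t₀, ∀ L ∈ {L : List (Fin N) | L.length ≤ Lθ.length},
        ∀ x ∈ K, ∀ θ : Fin N → ℝ,
          ‖symbolDeriv Lx L (fun x' θ' => a t x' θ' - a t₀ x' θ') x θ‖ ≤
            ε / (2 ^ Lθ.length * (C + 1)) *
              jweight (m - ρ * (L.length : ℝ) + δ * (Lx.length : ℝ)) θ :=
      (eventually_all_finite (List.finite_length_le (Fin N) Lθ.length)).2 fun L _ =>
        ha.2 t₀ K hKW hK Lx L _ (by positivity)
    filter_upwards [hev] with t ht x hx θ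
    simp only [← mul_sub]
    refine (norm_symbolDeriv_cutoff_le hW hc ((ha.smooth t).sub (ha.smooth t₀)) (hKW hx)
      (fun L hL => hC L hL θ) fun L hL => ht L hL x hx θ).trans ?_
    refine mul_le_mul_of_nonneg_right ?_ (jweight_pos _ θ).le
    have : 2 ^ Lθ.length * (C * (ε / (2 ^ Lθ.length * (C + 1)))) = ε * (C / (C + 1)) := by
      field_simp
    rw [this]
    exact mul_le_of_le_one_right hε.le ((div_le_one (by positivity)).2 (by linarith))

/-- A continuous family can be modified by a smoothing family so as to vanish for small
frequencies and to be small, over given compact sets, in the topology of one order higher. -/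
lemma IsContinuousSymbolFamily.exists_small_modification (hρ1 : ρ ≤ 1) (hW : IsOpen W)
    (ha : IsContinuousSymbolFamily ρ δ m W a) {Q : Set T} (hQ : IsCompact Q)
    {K : Set (Fin n → ℝ)} (hKW : K ⊆ W) (hK : IsCompact K) (l : ℕ) {ε : ℝ} (hε : 0 < ε)
    (R₀ : ℝ) :
    ∃ g : T → (Fin n → ℝ) → (Fin N → ℝ) → ℂ, IsContinuousSymbolFamily ρ δ m W g ∧
      (∀ t x θ, ‖θ‖ < R₀ → g t x θ = 0) ∧
      (∀ m', IsContinuousSymbolFamily ρ δ m' W (fun t x θ => g t x θ - a t x θ)) ∧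
      ∀ (Lx : List (Fin n)) (Lθ : List (Fin N)), Lx.length ≤ l → Lθ.length ≤ l →
        ∀ t ∈ Q, ∀ x ∈ K, ∀ θ, ‖symbolDeriv Lx Lθ (g t) x θ‖ ≤
          ε * jweight (m + 1 - ρ * Lθ.length + δ * Lx.length) θ := by
  have hU : IsOpen (W ×ˢ (Set.univ : Set (Fin N → ℝ))) := hW.prod isOpen_univ
  obtain ⟨b, hb, hb1, hb0, hbC⟩ := exists_uniform_bump (N := N) hρ1
  obtain ⟨C, hC0, hC⟩ := exists_uniform_of_length_le
    (P := fun L C => ∀ R, 1 ≤ R → ∀ θ, ‖thetaDeriv L (b R) θ‖ ≤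
      C * jweight (0 - ρ * L.length) θ) (fun L C C' hCC h R hR θ => (h R hR θ).trans
      (mul_le_mul_of_nonneg_right hCC (jweight_pos _ θ).le)) hbC l
  obtain ⟨A, hA0, hA⟩ := exists_uniform_of_length_le
    (P := fun Lx A => ∀ Lθ : List (Fin N), Lθ.length ≤ l → ∀ t ∈ Q, ∀ x ∈ K, ∀ θ,
      ‖symbolDeriv Lx Lθ (a t) x θ‖ ≤ A * jweight (m - ρ * Lθ.length + δ * Lx.length) θ)
    (fun Lx A A' hAA h Lθ hl t ht x hx θ => (h Lθ hl t ht x hx θ).trans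
      (mul_le_mul_of_nonneg_right hAA (jweight_pos _ θ).le))
    (fun Lx => (exists_uniform_of_length_le
      (P := fun Lθ A => ∀ t ∈ Q, ∀ x ∈ K, ∀ θ,
        ‖symbolDeriv Lx Lθ (a t) x θ‖ ≤ A * jweight (m - ρ * Lθ.length + δ * Lx.length) θ)
      (fun Lθ A A' hAA h t ht x hx θ => (h t ht x hx θ).trans
        (mul_le_mul_of_nonneg_right hAA (jweight_pos _ θ).le))
      (fun Lθ => ha.exists_bound_of_isCompact hW hQ hKW hK Lx Lθ) l).imp fun _ h => h.2) l
  set B : ℝ := A + 2 ^ l * (C * A) with hB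
  have hB0 : 0 ≤ B := by positivity
  obtain ⟨R, hR⟩ : ∃ R : ℝ, R = max (max 1 R₀) (B / ε) := ⟨_, rfl⟩
  have hR1 : 1 ≤ R := hR ▸ (le_max_left _ _).trans (le_max_left _ _)
  have hRR : R₀ ≤ R := hR ▸ (le_max_right _ _).trans (le_max_left _ _)
  have hRB : B ≤ ε * R := by
    have : B / ε ≤ R := hR ▸ le_max_right _ _
    rwa [div_le_iff₀ hε, mul_comm] at this
  have hba : ∀ m', IsContinuousSymbolFamily ρ δ m' W (fun t x θ => b R θ * a t x θ) := by
    intro m'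
    have := ha.cutoff_mul hW (hb R) (s := m' - m) fun L =>
      exists_norm_thetaDeriv_le_of_eq_zero (hb R) (hb0 R hR1) _ L
    simpa using this
  have hvan : ∀ t x θ, ‖θ‖ < R → a t x θ - b R θ * a t x θ = 0 := fun t x θ h => by
    rw [hb1 R hR1 θ h]; ring
  refine ⟨fun t x θ => a t x θ - b R θ * a t x θ, ha.sub hW (hba m),
    fun t x θ h => hvan t x θ (h.trans_le hRR), fun m' => ?_, ?_⟩
  · convert (hba m').neg using 4
    ring
  · intro Lx Lθ hLx hLθ t ht x hx θ
    rcases lt_or_ge ‖θ‖ R with h | h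
    · have hV : IsOpen {p : (Fin n → ℝ) × (Fin N → ℝ) | ‖p.2‖ < R} :=
        isOpen_lt continuous_snd.norm continuous_const
      rw [symbolDeriv_congr hV (fun x θ h => hvan t x θ h) Lx Lθ x θ h, symbolDeriv_zero,
        norm_zero]
      exact mul_nonneg hε.le (jweight_pos _ θ).le
    · rw [symbolDeriv_sub hU (ha.smooth t) ((hba m).smooth t) Lx Lθ x θ ⟨hKW hx, trivial⟩]
      have h1 := hA Lx hLx Lθ hLθ t ht x hx θ
      have h2 := norm_symbolDeriv_cutoff_le hW (hb R) (ha.smooth t) (hKW hx)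
        (fun L hL => hC L (hL.trans hLθ) R hR1 θ)
        (fun L hL => hA Lx hLx L (hL.trans hLθ) t ht x hx θ)
      rw [zero_add] at h2
      have hw : 0 < jweight (m - ρ * Lθ.length + δ * Lx.length) θ := jweight_pos _ θ
      have h3 : (2 : ℝ) ^ Lθ.length ≤ 2 ^ l := pow_le_pow_right₀ one_le_two hLθ
      have h4 : jweight (m + 1 - ρ * Lθ.length + δ * Lx.length) θ =
          jweight (m - ρ * Lθ.length + δ * Lx.length) θ * jweight 1 θ := by
        rw [← jweight_add]; congr 1; ring
      calc _ ≤ _ := norm_sub_le _ _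
        _ ≤ (A + 2 ^ Lθ.length * (C * A)) * jweight (m - ρ * Lθ.length + δ * Lx.length) θ := by
          linarith
        _ ≤ B * jweight (m - ρ * Lθ.length + δ * Lx.length) θ := by
          rw [hB]; gcongr
        _ ≤ ε * jweight 1 θ * jweight (m - ρ * Lθ.length + δ * Lx.length) θ := by
          refine mul_le_mul_of_nonneg_right (hRB.trans ?_) hw.le
          exact mul_le_mul_of_nonneg_left (h.trans (norm_le_jweight_one θ)) hε.le
        _ = _ := by rw [h4]; ring

end Families

section Summation

variable {T : Type*} {n N : ℕ} {ρ δ : ℝ} {W : Set (Fin n → ℝ)}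
  {g : ℕ → T → (Fin n → ℝ) → (Fin N → ℝ) → ℂ}

lemma tsum_eq_sum_range_of_norm_lt (h0 : ∀ (j : ℕ) t x θ, ‖θ‖ < j → g j t x θ = 0) (t : T)
    (x : Fin n → ℝ) {θ : Fin N → ℝ} {M : ℕ} (hM : ‖θ‖ < M) :
    ∑' j, g j t x θ = ∑ j ∈ Finset.range M, g j t x θ :=
  tsum_eq_sum fun j hj => h0 j t x θ
    (hM.trans_le (by exact_mod_cast not_lt.1 (by simpa using hj)))

lemma summable_of_vanishing_of_norm_lt (h0 : ∀ (j : ℕ) t x θ, ‖θ‖ < j → g j t x θ = 0) (t : T)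
    (x : Fin n → ℝ) (θ : Fin N → ℝ) : Summable fun j => g j t x θ := by
  obtain ⟨M, hM⟩ := exists_nat_gt ‖θ‖
  exact summable_of_ne_finset_zero (s := Finset.range M) fun j hj => h0 j t x θ
    (hM.trans_le (by exact_mod_cast not_lt.1 (by simpa using hj)))

/-- Summation of continuous families whose terms vanish on growing balls of frequencies and
are eventually geometrically small in the topology of one order higher. -/
lemma IsContinuousSymbolFamily.tsum [TopologicalSpace T] (hW : IsOpen W) {m : ℕ → ℝ} {μ : ℝ}
    (hm : Tendsto m atTop atBot) (hμ : ∀ j, m j ≤ μ)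
    (hg : ∀ j, IsContinuousSymbolFamily ρ δ (m j) W (g j))
    (h0 : ∀ (j : ℕ) t x θ, ‖θ‖ < j → g j t x θ = 0)
    (hs : ∀ t₀ : T, ∀ K ⊆ W, IsCompact K → ∀ (Lx : List (Fin n)) (Lθ : List (Fin N)),
      ∃ J : ℕ, ∀ᶠ t in nhds t₀, ∀ j ≥ J, ∀ x ∈ K, ∀ θ : Fin N → ℝ,
        ‖symbolDeriv Lx Lθ (g j t) x θ‖ ≤
          (1 / 2) ^ j * jweight (m j + 1 - ρ * Lθ.length + δ * Lx.length) θ) :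
    IsContinuousSymbolFamily ρ δ μ W (fun t x θ => ∑' j, g j t x θ) := by
  have hU : IsOpen (W ×ˢ (Set.univ : Set (Fin N → ℝ))) := hW.prod isOpen_univ
  have hV : ∀ M : ℕ, IsOpen {p : (Fin n → ℝ) × (Fin N → ℝ) | ‖p.2‖ < M} := fun M =>
    isOpen_lt continuous_snd.norm continuous_const
  refine .of_approx hW (fun t p hp => ?_) fun t₀ K hKW hK Lx Lθ ε hε => ?_
  · obtain ⟨M, hM⟩ := exists_nat_gt ‖p.2‖
    have hsum : SymbolSmoothOn (W ×ˢ Set.univ) fun x θ => ∑ j ∈ Finset.range M, g j t x θ :=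
      SymbolSmoothOn.sum fun j _ => (hg j).smooth t
    refine ((ContDiffOn.contDiffAt hsum (hU.mem_nhds hp)).congr_of_eventuallyEq
      ?_).contDiffWithinAt
    exact mem_of_superset ((hV M).mem_nhds hM) fun q hq =>
      tsum_eq_sum_range_of_norm_lt h0 t q.1 hq
  · obtain ⟨J₀, hJ₀⟩ := hs t₀ K hKW hK Lx Lθ
    obtain ⟨J₁, hJ₁⟩ := eventually_atTop.1 (hm.eventually_le_atBot (μ - 1))
    obtain ⟨J₂, hJ₂⟩ := exists_pow_lt_of_lt_one (half_pos hε) (by norm_num : (1 / 2 : ℝ) < 1)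
    let J := J₀ + J₁ + J₂
    refine ⟨fun t x θ => ∑ j ∈ Finset.range J, g j t x θ,
      .sum hW _ fun j => (hg j).mono (hμ j), ?_⟩
    filter_upwards [hJ₀] with t ht x hx θ
    obtain ⟨M, hM⟩ := exists_nat_gt ‖θ‖
    have hM' : ‖θ‖ < (J + M : ℕ) := hM.trans_le (by simp)
    rw [symbolDeriv_congr (hV (J + M)) (b := fun x θ => ∑ j ∈ Finset.Ico J (J + M), g j t x θ)
      (fun x' θ' h => by
        rw [tsum_eq_sum_range_of_norm_lt h0 t x' h,
          ← Finset.sum_range_add_sum_Ico _ (Nat.le_add_right J M), add_sub_cancel_left])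
      Lx Lθ x θ hM',
      symbolDeriv_sum hU _ (fun j => (hg j).smooth t) Lx Lθ x θ ⟨hKW hx, trivial⟩]
    calc _ ≤ ∑ j ∈ Finset.Ico J (J + M), ‖symbolDeriv Lx Lθ (g j t) x θ‖ := norm_sum_le _ _
      _ ≤ ∑ j ∈ Finset.Ico J (J + M),
          (1 / 2) ^ j * jweight (μ - ρ * Lθ.length + δ * Lx.length) θ := by
        refine Finset.sum_le_sum fun j hj => ?_
        have hj := (Finset.mem_Ico.1 hj).1
        have hmj := hJ₁ j (by omega)
        exact (ht j (by omega) x hx θ).trans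
          (mul_le_mul_of_nonneg_left (jweight_mono (by linarith) θ) (by positivity))
      _ = (∑ j ∈ Finset.Ico J (J + M), (1 / 2 : ℝ) ^ j) *
          jweight (μ - ρ * Lθ.length + δ * Lx.length) θ := by rw [Finset.sum_mul]
      _ ≤ ε * jweight (μ - ρ * Lθ.length + δ * Lx.length) θ := by
        refine mul_le_mul_of_nonneg_right ?_ (jweight_pos _ θ).le
        have h1 := geom_sum_Ico_le_of_lt_one (x := (1 / 2 : ℝ)) (m := J) (n := J + M)
          (by norm_num) (by norm_num)
        have h2 : (1 / 2 : ℝ) ^ J ≤ (1 / 2) ^ J₂ :=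
          pow_le_pow_of_le_one (by norm_num) (by norm_num) (by omega)
        have h3 : (1 / 2 : ℝ) ^ J / (1 - 1 / 2) = 2 * (1 / 2) ^ J := by ring
        linarith

end Summation

/-- continuous-families version of Shubin's Proposition 3.5, asymptotic
summation: given continuous families `F j` with values in `S^{m j}_{ρ,δ}(W × ℝ^N)` where
`m j → -∞`, with `k` the maximum of the `m j` and `mbar r` the maximum of `m j` for `j ≥ r`,
there is a continuous family `Fs` with values in `S^k_{ρ,δ}` such that
`Fs - ∑_{j<r} F j` is a continuous family with values in `S^{mbar r}_{ρ,δ}` for every `r ≥ 1`;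
moreover `Fs` is unique modulo smoothing families. -/
theorem asymptotic_sum_exists_unique
    {T : Type*} [TopologicalSpace T] [LocallyCompactSpace T]
    [SecondCountableTopology T] [T2Space T]
    {n N : ℕ} (hN : 1 ≤ N)
    (ρ δ : ℝ) (hδ0 : 0 ≤ δ) (hδρ : δ < ρ) (hρ1 : ρ ≤ 1)
    (W : Set (Fin n → ℝ)) (hW : IsOpen W)
    (m : ℕ → ℝ) (hm : Tendsto m atTop atBot)
    (k : ℝ) (hk : IsGreatest (Set.range m) k)
    (mbar : ℕ → ℝ) (hmbar : ∀ r : ℕ, IsGreatest (m '' Set.Ici r) (mbar r))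
    (F : ℕ → T → (Fin n → ℝ) → (Fin N → ℝ) → ℂ)
    (hF : ∀ j, IsContinuousSymbolFamily ρ δ (m j) W (F j)) :
    ∃ Fs : T → (Fin n → ℝ) → (Fin N → ℝ) → ℂ,
      IsContinuousSymbolFamily ρ δ k W Fs ∧
      (∀ r : ℕ, 1 ≤ r →
        IsContinuousSymbolFamily ρ δ (mbar r) W
          (fun t x θ => Fs t x θ - ∑ j ∈ Finset.range r, F j t x θ)) ∧
      ∀ Fs' : T → (Fin n → ℝ) → (Fin N → ℝ) → ℂ,
        (∀ r : ℕ, 1 ≤ r →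
          IsContinuousSymbolFamily ρ δ (mbar r) W
            (fun t x θ => Fs' t x θ - ∑ j ∈ Finset.range r, F j t x θ)) →
        ∀ m' : ℝ, IsContinuousSymbolFamily ρ δ m' W
          (fun t x θ => Fs t x θ - Fs' t x θ) := by
  have : LocallyCompactSpace W := hW.locallyCompactSpace
  obtain τ : CompactExhaustion T := CompactExhaustion.choice T
  obtain κ : CompactExhaustion W := CompactExhaustion.choice W
  have hmod := fun j : ℕ => (hF j).exists_small_modification hρ1 hW (τ.isCompact j)
    (K := Subtype.val '' κ j) (by rintro _ ⟨x, _, rfl⟩; exact x.2)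
    ((κ.isCompact j).image continuous_subtype_val) j (ε := (1 / 2) ^ j) (by positivity) j
  choose g hg hg0 hgF hgs using hmod
  have hsmall : ∀ t₀ : T, ∀ K ⊆ W, IsCompact K → ∀ (Lx : List (Fin n)) (Lθ : List (Fin N)),
      ∃ J : ℕ, ∀ᶠ t in nhds t₀, ∀ j ≥ J, ∀ x ∈ K, ∀ θ : Fin N → ℝ,
        ‖symbolDeriv Lx Lθ (g j t) x θ‖ ≤
          (1 / 2) ^ j * jweight (m j + 1 - ρ * Lθ.length + δ * Lx.length) θ := by
    intro t₀ K hKW hK Lx Lθ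
    obtain ⟨J₁, hJ₁⟩ := τ.exists_mem_nhds t₀
    have hK' : IsCompact (Subtype.val ⁻¹' K : Set W) := by
      rw [Subtype.isCompact_iff, Subtype.image_preimage_coe, Set.inter_eq_right.2 hKW]
      exact hK
    obtain ⟨J₂, hJ₂⟩ := κ.exists_superset_of_isCompact hK'
    refine ⟨J₁ + J₂ + Lx.length + Lθ.length, ?_⟩
    filter_upwards [hJ₁] with t ht j hj x hx θ
    exact hgs j Lx Lθ (by omega) (by omega) t (τ.subset (by omega) ht) x
      ⟨⟨x, hKW hx⟩, κ.subset (by omega : J₂ ≤ j) (hJ₂ hx), rfl⟩ θ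
  have hrem : ∀ r : ℕ, 1 ≤ r → IsContinuousSymbolFamily ρ δ (mbar r) W
      (fun t x θ => (∑' j, g j t x θ) - ∑ j ∈ Finset.range r, F j t x θ) := by
    intro r _
    have htail : IsContinuousSymbolFamily ρ δ (mbar r) W
        (fun t x θ => ∑' j, g (j + r) t x θ) := by
      refine IsContinuousSymbolFamily.tsum hW ((tendsto_add_atTop_iff_nat r).2 hm)
        (fun j => (hmbar r).2 ⟨j + r, by simp, rfl⟩) (fun j => hg (j + r))
        (fun j t x θ h => hg0 (j + r) t x θ (h.trans_le (by simp))) ?_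
      intro t₀ K hKW hK Lx Lθ
      obtain ⟨J, hJ⟩ := hsmall t₀ K hKW hK Lx Lθ
      refine ⟨J, ?_⟩
      filter_upwards [hJ] with t ht j hj x hx θ
      exact (ht (j + r) (by omega) x hx θ).trans (mul_le_mul_of_nonneg_right
        (pow_le_pow_of_le_one (by norm_num) (by norm_num) (by omega)) (jweight_pos _ θ).le)
    convert htail.add hW (IsContinuousSymbolFamily.sum hW (Finset.range r)
      fun j => hgF j (mbar r)) using 4 with t x θ
    rw [← (summable_of_vanishing_of_norm_lt hg0 t x θ).sum_add_tsum_nat_add r,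
      Finset.sum_sub_distrib]
    ring
  refine ⟨fun t x θ => ∑' j, g j t x θ,
    IsContinuousSymbolFamily.tsum hW hm (fun j => hk.2 ⟨j, rfl⟩) hg hg0 hsmall, hrem, ?_⟩
  intro Fs' hFs' m'
  obtain ⟨r, hr⟩ := eventually_atTop.1 (hm.eventually_le_atBot m')
  have hle : mbar (r + 1) ≤ m' := by
    obtain ⟨j, hj, hjm⟩ := (hmbar (r + 1)).1
    rw [← hjm]
    exact hr j ((Nat.le_succ r).trans hj)
  have h := ((hrem (r + 1) (by omega)).sub hW (hFs' (r + 1) (by omega))).mono hle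
  simpa only [sub_sub_sub_cancel_right] using h
end

section
/- Let T be a locally compact Hausdorff space, N ≥ 1, m ∈ ℝ, 0 ≤ δ < ρ ≤ 1, and let σ : T × ℝ^N × ℝ^N → ℂ be a continuous family with values in S^m_{ρ,δ}(ℝ^N × ℝ^N). Let f : T × ℝ^N → ℂ be continuous with compact support, such that each f^t := f(t,·) is smooth and the map t ↦ f^t is continuous into C^∞(ℝ^N) (uniform convergence of all derivatives on compact sets). Define Af(t,x) = ∫_{ℝ^N} e^{2πi x·ξ} σ(t,x,ξ) (𝓕 f^t)(ξ) dξ, where 𝓕 f^t(ξ) = ∫ e^{−2πi y·ξ} f^t(y) dy (the integral converges absolutely since 𝓕 f^t is Schwartz and σ(t,x,·) has at most polynomial growth). Then Af is a C^{∞,0} function on T × ℝ^N: for each t the function x ↦ Af(t,x) is smooth, and for every multi-index β the function (t,x) ↦ ∂^β_x Af(t,x) is jointly continuous on T × ℝ^N. (Claim from Section 4 of the paper that a continuous family of pseudodifferential operators maps C_c^{∞,0}(T × W) into C^{∞,0}(T × W).) -/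
open MeasureTheory Filter

/-- The dot product `x · ξ = ∑ i, x i * ξ i` on `ℝ^N`. -/
noncomputable def dotProd {N : ℕ} (x ξ : Fin N → ℝ) : ℝ := ∑ i, x i * ξ i

/-- The Fourier transform `𝓕 f (ξ) = ∫ e^{-2πi y·ξ} f(y) dy`. -/
noncomputable def fourierT {N : ℕ} (f : (Fin N → ℝ) → ℂ) (ξ : Fin N → ℝ) : ℂ :=
  ∫ y : Fin N → ℝ, Complex.exp (-(2 * (Real.pi : ℂ) * Complex.I * (dotProd y ξ : ℂ))) * f y

/-- The pseudodifferential operator with symbol `σ`: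
`A_σ f (x) = ∫ e^{2πi x·ξ} σ(x,ξ) 𝓕f(ξ) dξ`. -/
noncomputable def pdoApply {N : ℕ} (σ : (Fin N → ℝ) → (Fin N → ℝ) → ℂ)
    (f : (Fin N → ℝ) → ℂ) (x : Fin N → ℝ) : ℂ :=
  ∫ ξ : Fin N → ℝ,
    Complex.exp (2 * (Real.pi : ℂ) * Complex.I * (dotProd x ξ : ℂ)) * σ x ξ * fourierT f ξ

/-- Partial derivative of `f : ℝ^N → ℂ` in the `i`-th coordinate direction. -/
noncomputable def pd1 {N : ℕ} (i : Fin N) (f : (Fin N → ℝ) → ℂ) : (Fin N → ℝ) → ℂ :=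
  fun x => fderiv ℝ f x (Pi.single i 1)

/-- Iterated partial derivative `∂^β_x f` along a list of coordinate directions. -/
noncomputable def derivList {N : ℕ} (L : List (Fin N)) (f : (Fin N → ℝ) → ℂ) :
    (Fin N → ℝ) → ℂ :=
  L.foldr pd1 f

open scoped FourierTransform

section

variable {T : Type*} [TopologicalSpace T] {N : ℕ}

/-- The dot product on `ℝ^N` as a continuous bilinear map. -/
noncomputable def dotProdL (N : ℕ) : (Fin N → ℝ) →L[ℝ] (Fin N → ℝ) →L[ℝ] ℝ :=
  ∑ i, (ContinuousLinearMap.mul ℝ ℝ).bilinearComp (ContinuousLinearMap.proj i)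
    (ContinuousLinearMap.proj i)

theorem dotProdL_apply (x ξ : Fin N → ℝ) : dotProdL N x ξ = dotProd x ξ := by
  simp [dotProdL, dotProd]

theorem dotProd_single (j : Fin N) (ξ : Fin N → ℝ) : dotProd (Pi.single j 1) ξ = ξ j := by
  simp [dotProd, Pi.single_apply]

theorem fourierT_eq_fourierIntegral (h : (Fin N → ℝ) → ℂ) :
    fourierT h = VectorFourier.fourierIntegral 𝐞 volume (dotProdL N).toLinearMap₁₂ h := by
  ext ξ
  simp only [fourierT, VectorFourier.fourierIntegral, Circle.smul_def, Real.fourierChar_apply,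
    smul_eq_mul, ContinuousLinearMap.toLinearMap₁₂_apply_apply_apply, dotProdL_apply]
  refine integral_congr_ae (Eventually.of_forall fun y => ?_)
  dsimp only
  congr 2
  push_cast
  ring

theorem continuous_fourierT {h : (Fin N → ℝ) → ℂ} (hh : Integrable h) :
    Continuous (fourierT h) := by
  rw [fourierT_eq_fourierIntegral]
  exact VectorFourier.fourierIntegral_continuous Real.continuous_fourierChar
    (dotProdL N).continuous₂ hh

theorem fourierT_sub {h k : (Fin N → ℝ) → ℂ} (hh : Integrable h) (hk : Integrable k)
    (ξ : Fin N → ℝ) :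
    fourierT (fun x => h x - k x) ξ = fourierT h ξ - fourierT k ξ := by
  have hI {g : (Fin N → ℝ) → ℂ} (hg : Integrable g) : Integrable fun y =>
      Complex.exp (-(2 * (Real.pi : ℂ) * Complex.I * (dotProd y ξ : ℂ))) * g y := by
    refine hg.bdd_mul (c := 1) ?_ (Eventually.of_forall fun y => ?_)
    · simp only [dotProd]
      exact Continuous.aestronglyMeasurable (by fun_prop)
    · rw [Complex.norm_exp]
      simp
  simp only [fourierT, mul_sub]
  exact integral_sub (hI hh) (hI hk)

/-- A compact set carries uniform polynomial decay of Fourier transforms, controlled by the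
derivatives of the transformed function. -/
theorem exists_fourierT_decay (hN : 1 ≤ N) {K : Set (Fin N → ℝ)} (hK : IsCompact K) (n : ℕ) :
    ∃ C : ℝ, 0 ≤ C ∧ ∀ h : (Fin N → ℝ) → ℂ, ContDiff ℝ (⊤ : ℕ∞) h → (∀ x ∉ K, h x = 0) →
      ∀ B : ℝ, (∀ q ≤ n, ∀ x ∈ K, ‖iteratedFDeriv ℝ q h x‖ ≤ B) →
        ∀ ξ, (1 + ‖ξ‖) ^ n * ‖fourierT h ξ‖ ≤ C * B := by
  refine ⟨2 ^ n * (volume.real K + 2 ^ n * ((n + 1) * volume.real K)), by positivity, ?_⟩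
  intro h hh hsupp B hB ξ
  have hts : tsupport h ⊆ K := by
    refine closure_minimal (fun x hx => ?_) hK.isClosed
    by_contra hxK
    exact hx (hsupp x hxK)
  have hcs : HasCompactSupport h := hK.of_isClosed_subset (isClosed_tsupport h) hts
  have hcont (q : ℕ) : Continuous (iteratedFDeriv ℝ q h) :=
    hh.continuous_iteratedFDeriv (mod_cast le_top)
  have hInt (k q : ℕ) : Integrable fun v => ‖v‖ ^ k * ‖iteratedFDeriv ℝ q h v‖ := by
    refine Continuous.integrable_of_hasCompactSupport (by have := hcont q; fun_prop) ?_
    exact (hcs.iteratedFDeriv q).norm.mul_left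
  have hI (q : ℕ) (hq : q ≤ n) : ∫ v, ‖iteratedFDeriv ℝ q h v‖ ≤ volume.real K * B := by
    rw [← setIntegral_eq_integral_of_forall_compl_eq_zero (s := K)]
    · have := norm_setIntegral_le_of_norm_le_const (μ := volume) (s := K) (C := B)
        (f := fun v => ‖iteratedFDeriv ℝ q h v‖) hK.measure_lt_top
        (fun x hx => by simpa using hB q hq x hx)
      rw [mul_comm]
      exact (le_abs_self _).trans this
    · intro x hx
      have : x ∉ tsupport h := fun hx' => hx (hts hx')
      have h0 : iteratedFDeriv ℝ q h x = 0 := by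
        by_contra hne
        exact this (support_iteratedFDeriv_subset q hne)
      simp [h0]
  have hdec (k : ℕ) (hk : k ≤ n) (j : Fin N) :
      |ξ j| ^ k * ‖fourierT h ξ‖ ≤ 2 ^ k * ((k + 1) * (volume.real K * B)) := by
    have := VectorFourier.pow_mul_norm_iteratedFDeriv_fourierIntegral_le (dotProdL N)
      (μ := volume) (K := ⊤) (N := ⊤) hh (fun k n _ _ => hInt k n) (k := 0) (n := k)
      le_top le_top (Pi.single j 1) ξ
    rw [dotProdL_apply, dotProd_single, ← fourierT_eq_fourierIntegral] at this
    simp only [norm_iteratedFDeriv_zero] at this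
    refine this.trans ?_
    have hs : ∑ p ∈ Finset.range (0 + 1) ×ˢ Finset.range (k + 1),
        ∫ v, ‖v‖ ^ p.1 * ‖iteratedFDeriv ℝ p.2 h v‖ ≤ (k + 1) * (volume.real K * B) := by
      refine (Finset.sum_le_card_nsmul _ _ (volume.real K * B) fun p hp => ?_).trans (by simp)
      simp only [zero_add, Finset.range_one, Finset.mem_product, Finset.mem_singleton,
        Finset.mem_range] at hp
      simpa [hp.1] using hI p.2 (by omega)
    have hsingle : ‖(Pi.single j 1 : Fin N → ℝ)‖ = 1 := by simp [Pi.norm_single]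
    simp only [hsingle, one_pow, pow_zero, Nat.cast_zero, mul_zero, zero_add, one_mul] at hs ⊢
    exact mul_le_mul_of_nonneg_left hs (by positivity : (0 : ℝ) ≤ 2 ^ k)
  have : Nonempty (Fin N) := ⟨⟨0, hN⟩⟩
  obtain ⟨j, hj⟩ : ∃ j, ‖ξ‖ = ‖ξ j‖ := by
    obtain ⟨j, -, hj⟩ := Finset.exists_mem_eq_sup' (Finset.univ_nonempty (α := Fin N))
      (fun i => ‖ξ i‖)
    refine ⟨j, le_antisymm ?_ (norm_le_pi_norm ξ j)⟩
    rw [← hj]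
    exact (pi_norm_le_iff_of_nonempty _).2 fun i =>
      Finset.le_sup' (fun i => ‖ξ i‖) (Finset.mem_univ i)
  have h0 := hdec 0 (Nat.zero_le n) j
  have hn := hdec n le_rfl j
  rw [← Real.norm_eq_abs, ← hj] at h0 hn
  have hpow : (1 + ‖ξ‖) ^ n ≤ 2 ^ n * (1 + ‖ξ‖ ^ n) := by
    refine (add_pow_le zero_le_one (norm_nonneg ξ) n).trans ?_
    rw [one_pow]
    gcongr
    · norm_num
    · omega
  calc (1 + ‖ξ‖) ^ n * ‖fourierT h ξ‖ ≤ 2 ^ n * (1 + ‖ξ‖ ^ n) * ‖fourierT h ξ‖ := by gcongr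
    _ = 2 ^ n * (‖ξ‖ ^ 0 * ‖fourierT h ξ‖ + ‖ξ‖ ^ n * ‖fourierT h ξ‖) := by ring
    _ ≤ 2 ^ n * (2 ^ 0 * (((0 : ℕ) + 1) * (volume.real K * B))
          + 2 ^ n * ((n + 1) * (volume.real K * B))) := by gcongr
    _ = _ := by push_cast; ring

/-- `SmoothSymbol a` says that `a(x, θ)` is smooth in both variables jointly. -/
def SmoothSymbol (a : (Fin N → ℝ) → (Fin N → ℝ) → ℂ) : Prop :=
  ContDiff ℝ (⊤ : ℕ∞) fun p : (Fin N → ℝ) × (Fin N → ℝ) => a p.1 p.2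

namespace SmoothSymbol

variable {a b : (Fin N → ℝ) → (Fin N → ℝ) → ℂ}

theorem continuous_right (ha : SmoothSymbol a) (x : Fin N → ℝ) : Continuous (a x) :=
  ha.continuous.comp (Continuous.prodMk_right x)

theorem differentiable_left (ha : SmoothSymbol a) (θ : Fin N → ℝ) :
    Differentiable ℝ fun x => a x θ :=
  (ha.comp (contDiff_prodMk_left θ)).differentiable (by simp)

theorem add (ha : SmoothSymbol a) (hb : SmoothSymbol b) :
    SmoothSymbol fun x θ => a x θ + b x θ :=
  ContDiff.add ha hb

theorem sub (ha : SmoothSymbol a) (hb : SmoothSymbol b) :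
    SmoothSymbol fun x θ => a x θ - b x θ :=
  ContDiff.sub ha hb

theorem coord_mul (ha : SmoothSymbol a) (c : ℂ) (i : Fin N) :
    SmoothSymbol fun x θ => c * (θ i : ℂ) * a x θ := by
  refine ContDiff.mul (contDiff_const.mul ?_) ha
  exact Complex.ofRealCLM.contDiff.comp ((contDiff_apply ℝ ℝ i).comp contDiff_snd)

theorem pdX (ha : SmoothSymbol a) (i : Fin N) : SmoothSymbol (pdX i a) := by
  refine ContDiff.clm_apply (ContDiff.fderiv (m := (⊤ : ℕ∞))
    (f := fun (p : (Fin N → ℝ) × (Fin N → ℝ)) x' => a x' p.2) ?_ contDiff_fst ?_) contDiff_const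
  · exact ContDiff.comp (g := fun p : (Fin N → ℝ) × (Fin N → ℝ) => a p.1 p.2) ha
      (f := fun q : ((Fin N → ℝ) × (Fin N → ℝ)) × (Fin N → ℝ) => (q.2, q.1.2)) (by fun_prop)
  · simp

theorem foldr_pdX (ha : SmoothSymbol a) (L : List (Fin N)) :
    SmoothSymbol (L.foldr _root_.pdX a) := by
  induction L with
  | nil => exact ha
  | cons i L ih => exact ih.pdX i

end SmoothSymbol

theorem foldr_pdX_add {a b : (Fin N → ℝ) → (Fin N → ℝ) → ℂ} (ha : SmoothSymbol a)
    (hb : SmoothSymbol b) (L : List (Fin N)) :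
    L.foldr pdX (fun x θ => a x θ + b x θ) =
      fun x θ => L.foldr pdX a x θ + L.foldr pdX b x θ := by
  induction L with
  | nil => rfl
  | cons i L ih =>
    simp only [List.foldr_cons, ih]
    ext x θ
    simp only [pdX]
    rw [fderiv_fun_add ((ha.foldr_pdX L).differentiable_left θ x)
      ((hb.foldr_pdX L).differentiable_left θ x)]
    rfl

theorem foldr_pdX_coord_mul {a : (Fin N → ℝ) → (Fin N → ℝ) → ℂ} (ha : SmoothSymbol a)
    (c : ℂ) (i : Fin N) (L : List (Fin N)) :
    L.foldr pdX (fun x θ => c * (θ i : ℂ) * a x θ) =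
      fun x θ => c * (θ i : ℂ) * L.foldr pdX a x θ := by
  induction L with
  | nil => rfl
  | cons k L ih =>
    simp only [List.foldr_cons, ih]
    ext x θ
    simp only [pdX]
    rw [fderiv_const_mul ((ha.foldr_pdX L).differentiable_left θ x)]
    rfl

/-- The symbol `∂_{x_i} a + 2πi θ_i a`, whose operator is the `i`-th derivative of the operator
with symbol `a`. -/
noncomputable def derivSymbol (i : Fin N) (a : (Fin N → ℝ) → (Fin N → ℝ) → ℂ) :
    (Fin N → ℝ) → (Fin N → ℝ) → ℂ :=
  fun x θ => pdX i a x θ + 2 * (Real.pi : ℂ) * Complex.I * (θ i : ℂ) * a x θ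

theorem SmoothSymbol.derivSymbol {a : (Fin N → ℝ) → (Fin N → ℝ) → ℂ} (ha : SmoothSymbol a)
    (i : Fin N) : SmoothSymbol (derivSymbol i a) :=
  (ha.pdX i).add (ha.coord_mul _ i)

theorem derivSymbol_sub {a b : (Fin N → ℝ) → (Fin N → ℝ) → ℂ} (ha : SmoothSymbol a)
    (hb : SmoothSymbol b) (i : Fin N) :
    derivSymbol i (fun x θ => a x θ - b x θ) =
      fun x θ => derivSymbol i a x θ - derivSymbol i b x θ := by
  ext x θ
  simp only [derivSymbol, pdX]
  rw [fderiv_fun_sub (ha.differentiable_left θ x) (hb.differentiable_left θ x),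
    sub_apply]
  ring

/-- `PolyBound K L s C a`: on `K`, the `x`-derivative of `a` along `L` is at most
`C (1 + |θ|)^s`. -/
def PolyBound (K : Set (Fin N → ℝ)) (L : List (Fin N)) (s : ℕ) (C : ℝ)
    (a : (Fin N → ℝ) → (Fin N → ℝ) → ℂ) : Prop :=
  ∀ x ∈ K, ∀ θ, ‖L.foldr pdX a x θ‖ ≤ C * (1 + ‖θ‖) ^ s

theorem PolyBound.derivSymbol {a : (Fin N → ℝ) → (Fin N → ℝ) → ℂ} (ha : SmoothSymbol a)
    {K : Set (Fin N → ℝ)} {L : List (Fin N)} {i : Fin N} {s₁ s₂ : ℕ} {C₁ C₂ : ℝ}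
    (hC₁ : 0 ≤ C₁) (hC₂ : 0 ≤ C₂) (h₁ : PolyBound K (L ++ [i]) s₁ C₁ a)
    (h₂ : PolyBound K L s₂ C₂ a) :
    PolyBound K L (s₁ + s₂ + 1) (C₁ + 2 * Real.pi * C₂) (derivSymbol i a) := by
  intro x hx θ
  have h : L.foldr pdX (_root_.derivSymbol i a) x θ =
      (L ++ [i]).foldr pdX a x θ +
        2 * (Real.pi : ℂ) * Complex.I * (θ i : ℂ) * L.foldr pdX a x θ := by
    unfold _root_.derivSymbol
    rw [foldr_pdX_add (ha.pdX i) (ha.coord_mul _ i), foldr_pdX_coord_mul ha]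
    simp
  have hone : 1 ≤ 1 + ‖θ‖ := by linarith [norm_nonneg θ]
  have hθ : ‖(θ i : ℂ)‖ ≤ 1 + ‖θ‖ := by
    have := norm_le_pi_norm θ i
    rw [Complex.norm_real]
    linarith
  rw [h]
  calc _ ≤ ‖(L ++ [i]).foldr pdX a x θ‖ +
        ‖2 * (Real.pi : ℂ) * Complex.I * (θ i : ℂ) * L.foldr pdX a x θ‖ := norm_add_le _ _
    _ = ‖(L ++ [i]).foldr pdX a x θ‖ +
        2 * Real.pi * (‖(θ i : ℂ)‖ * ‖L.foldr pdX a x θ‖) := by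
        simp only [norm_mul, Complex.norm_I, Complex.norm_ofNat,
          Complex.norm_of_nonneg Real.pi_pos.le]
        ring
    _ ≤ C₁ * (1 + ‖θ‖) ^ s₁ + 2 * Real.pi * ((1 + ‖θ‖) * (C₂ * (1 + ‖θ‖) ^ s₂)) := by
        gcongr
        · exact h₁ x hx θ
        · exact h₂ x hx θ
    _ = C₁ * (1 + ‖θ‖) ^ s₁ + 2 * Real.pi * (C₂ * (1 + ‖θ‖) ^ (s₂ + 1)) := by ring
    _ ≤ C₁ * (1 + ‖θ‖) ^ (s₁ + s₂ + 1) +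
        2 * Real.pi * (C₂ * (1 + ‖θ‖) ^ (s₁ + s₂ + 1)) := by
        gcongr <;> first | assumption | omega
    _ = _ := by ring

/-- A continuous family of smooth symbols whose `x`-derivatives have polynomial growth in `θ`. -/
structure IsPolyFamily (a : T → (Fin N → ℝ) → (Fin N → ℝ) → ℂ) : Prop where
  smooth : ∀ t, SmoothSymbol (a t)
  bound : ∀ L : List (Fin N), ∃ s : ℕ, ∀ K : Set (Fin N → ℝ), IsCompact K → ∀ t₀,
    (∃ C, 0 ≤ C ∧ PolyBound K L s C (a t₀)) ∧
    ∀ ε : ℝ, 0 < ε → ∀ᶠ t in nhds t₀, PolyBound K L s ε fun x θ => a t x θ - a t₀ x θ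

theorem IsPolyFamily.derivSymbol {a : T → (Fin N → ℝ) → (Fin N → ℝ) → ℂ} (ha : IsPolyFamily a)
    (i : Fin N) : IsPolyFamily fun t => derivSymbol i (a t) := by
  refine ⟨fun t => (ha.smooth t).derivSymbol i, fun L => ?_⟩
  obtain ⟨s₁, h₁⟩ := ha.bound (L ++ [i])
  obtain ⟨s₂, h₂⟩ := ha.bound L
  refine ⟨s₁ + s₂ + 1, fun K hK t₀ => ⟨?_, fun ε hε => ?_⟩⟩
  · obtain ⟨C₁, hC₁, hb₁⟩ := (h₁ K hK t₀).1
    obtain ⟨C₂, hC₂, hb₂⟩ := (h₂ K hK t₀).1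
    exact ⟨_, by positivity, hb₁.derivSymbol (ha.smooth t₀) hC₁ hC₂ hb₂⟩
  · set η := ε / (1 + 2 * Real.pi) with hη
    have hη0 : 0 < η := by positivity
    filter_upwards [(h₁ K hK t₀).2 η hη0, (h₂ K hK t₀).2 η hη0] with t hb₁ hb₂
    have := hb₁.derivSymbol ((ha.smooth t).sub (ha.smooth t₀)) hη0.le hη0.le hb₂
    rw [derivSymbol_sub (ha.smooth t) (ha.smooth t₀)] at this
    convert this using 1
    rw [hη]
    field_simp

theorem jweight_le_pow {r : ℝ} {s : ℕ} (hrs : r ≤ s) (θ : Fin N → ℝ) :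
    jweight r θ ≤ (1 + ‖θ‖) ^ s := by
  have hθ := norm_nonneg θ
  unfold jweight
  calc (1 + ‖θ‖ ^ 2) ^ (r / 2 : ℝ) ≤ (1 + ‖θ‖ ^ 2) ^ (s / 2 : ℝ) :=
        Real.rpow_le_rpow_of_exponent_le (by nlinarith) (by linarith)
    _ ≤ ((1 + ‖θ‖) ^ (2 : ℝ)) ^ (s / 2 : ℝ) := by
        refine Real.rpow_le_rpow (by positivity) ?_ (by positivity)
        rw [Real.rpow_two]
        nlinarith
    _ = (1 + ‖θ‖) ^ s := by
        rw [← Real.rpow_mul (by positivity), mul_div_cancel₀ _ two_ne_zero, Real.rpow_natCast]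

theorem IsContinuousSymbolFamily.isPolyFamily {ρ δ m : ℝ}
    {σ : T → (Fin N → ℝ) → (Fin N → ℝ) → ℂ}
    (hσ : IsContinuousSymbolFamily ρ δ m Set.univ σ) : IsPolyFamily σ := by
  refine ⟨fun t => by simpa [SmoothSymbol, contDiffOn_univ] using (hσ.1 t).1, fun L => ?_⟩
  obtain ⟨s, hs⟩ := exists_nat_ge (m - ρ * (([] : List (Fin N)).length : ℝ) + δ * L.length)
  refine ⟨s, fun K hK t₀ => ⟨?_, fun ε hε => ?_⟩⟩
  · obtain ⟨C, hC, hb⟩ := (hσ.1 t₀).2 K (Set.subset_univ K) hK L []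
    exact ⟨C, hC, fun x hx θ => (hb x hx θ).trans
      (mul_le_mul_of_nonneg_left (jweight_le_pow hs θ) hC)⟩
  · filter_upwards [hσ.2 t₀ K (Set.subset_univ K) hK L [] ε hε] with t hb x hx θ
    exact (hb x hx θ).trans (mul_le_mul_of_nonneg_left (jweight_le_pow hs θ) hε.le)

/-- The oscillatory integral `∫ e^{2πi x·ξ} a(x,ξ) g(ξ) dξ`. -/
noncomputable def oscIntegral (a : (Fin N → ℝ) → (Fin N → ℝ) → ℂ) (g : (Fin N → ℝ) → ℂ)
    (x : Fin N → ℝ) : ℂ :=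
  ∫ ξ : Fin N → ℝ,
    Complex.exp (2 * (Real.pi : ℂ) * Complex.I * (dotProd x ξ : ℂ)) * a x ξ * g ξ

theorem norm_exp_dotProd (x ξ : Fin N → ℝ) :
    ‖Complex.exp (2 * (Real.pi : ℂ) * Complex.I * (dotProd x ξ : ℂ))‖ = 1 := by
  rw [Complex.norm_exp]
  simp

theorem norm_phase_mul_le {c z : ℂ} {x ξ : Fin N → ℝ} {s : ℕ} {A B : ℝ} (hA : 0 ≤ A)
    (hc : ‖c‖ ≤ A * (1 + ‖ξ‖) ^ s) (hz : (1 + ‖ξ‖) ^ (s + (N + 1)) * ‖z‖ ≤ B) :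
    ‖Complex.exp (2 * (Real.pi : ℂ) * Complex.I * (dotProd x ξ : ℂ)) * c * z‖ ≤
      A * B * (1 + ‖ξ‖) ^ (-((N + 1 : ℕ) : ℝ)) := by
  have hpos : 0 < 1 + ‖ξ‖ := by positivity
  rw [norm_mul, norm_mul, norm_exp_dotProd, one_mul, Real.rpow_neg hpos.le, Real.rpow_natCast,
    ← div_eq_mul_inv, le_div_iff₀ (by positivity)]
  calc ‖c‖ * ‖z‖ * (1 + ‖ξ‖) ^ (N + 1)
      ≤ A * (1 + ‖ξ‖) ^ s * ‖z‖ * (1 + ‖ξ‖) ^ (N + 1) := by gcongr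
    _ = A * ((1 + ‖ξ‖) ^ (s + (N + 1)) * ‖z‖) := by ring
    _ ≤ A * B := by gcongr

theorem integrable_japanese (N : ℕ) :
    Integrable fun ξ : Fin N → ℝ => (1 + ‖ξ‖) ^ (-((N + 1 : ℕ) : ℝ)) :=
  integrable_one_add_norm (by simp)

theorem continuous_phase_mul {a : (Fin N → ℝ) → (Fin N → ℝ) → ℂ} {g : (Fin N → ℝ) → ℂ}
    (ha : SmoothSymbol a) (hg : Continuous g) (x : Fin N → ℝ) :
    Continuous fun ξ =>
      Complex.exp (2 * (Real.pi : ℂ) * Complex.I * (dotProd x ξ : ℂ)) * a x ξ * g ξ := by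
  have := ha.continuous_right x
  unfold dotProd
  fun_prop

theorem integrable_phase_mul {a : (Fin N → ℝ) → (Fin N → ℝ) → ℂ} {g : (Fin N → ℝ) → ℂ}
    (ha : SmoothSymbol a) (hg : Continuous g) {x : Fin N → ℝ} {s : ℕ} {A B : ℝ} (hA : 0 ≤ A)
    (hb : ∀ ξ, ‖a x ξ‖ ≤ A * (1 + ‖ξ‖) ^ s)
    (hB : ∀ ξ, (1 + ‖ξ‖) ^ (s + (N + 1)) * ‖g ξ‖ ≤ B) :
    Integrable fun ξ =>
      Complex.exp (2 * (Real.pi : ℂ) * Complex.I * (dotProd x ξ : ℂ)) * a x ξ * g ξ :=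
  ((integrable_japanese N).const_mul (A * B)).mono'
    (continuous_phase_mul ha hg x).aestronglyMeasurable
    (Eventually.of_forall fun ξ => norm_phase_mul_le hA (hb ξ) (hB ξ))

theorem norm_oscIntegral_le {a : (Fin N → ℝ) → (Fin N → ℝ) → ℂ} {g : (Fin N → ℝ) → ℂ}
    {x : Fin N → ℝ} {s : ℕ} {A B : ℝ} (hA : 0 ≤ A) (hb : ∀ ξ, ‖a x ξ‖ ≤ A * (1 + ‖ξ‖) ^ s)
    (hB : ∀ ξ, (1 + ‖ξ‖) ^ (s + (N + 1)) * ‖g ξ‖ ≤ B) :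
    ‖oscIntegral a g x‖ ≤ A * B * ∫ ξ : Fin N → ℝ, (1 + ‖ξ‖) ^ (-((N + 1 : ℕ) : ℝ)) := by
  rw [← integral_const_mul]
  exact norm_integral_le_of_norm_le ((integrable_japanese N).const_mul (A * B))
    (Eventually.of_forall fun ξ => norm_phase_mul_le hA (hb ξ) (hB ξ))

/-- Continuous functions decaying faster than every power. -/
structure IsRapidlyDecreasing (g : (Fin N → ℝ) → ℂ) : Prop where
  continuous : Continuous g
  decay : ∀ n : ℕ, ∃ B : ℝ, 0 ≤ B ∧ ∀ ξ, (1 + ‖ξ‖) ^ n * ‖g ξ‖ ≤ B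

theorem hasFDerivAt_phase_mul {a : (Fin N → ℝ) → (Fin N → ℝ) → ℂ} (ha : SmoothSymbol a)
    (z : ℂ) (x ξ : Fin N → ℝ) :
    HasFDerivAt (fun x => Complex.exp (2 * (Real.pi : ℂ) * Complex.I * (dotProd x ξ : ℂ)) *
        a x ξ * z)
      (∑ i, (ContinuousLinearMap.proj (R := ℝ) (φ := fun _ : Fin N => ℝ) i).smulRight
        (Complex.exp (2 * (Real.pi : ℂ) * Complex.I * (dotProd x ξ : ℂ)) *
          derivSymbol i a x ξ * z)) x := by
  have hdot : HasFDerivAt (fun x => (dotProd x ξ : ℂ))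
      (Complex.ofRealCLM.comp ((dotProdL N).flip ξ)) x := by
    simpa only [ContinuousLinearMap.coe_comp, Function.comp_def, ContinuousLinearMap.flip_apply,
      dotProdL_apply, Complex.ofRealCLM_apply] using
      (Complex.ofRealCLM.comp ((dotProdL N).flip ξ)).hasFDerivAt (x := x)
  have h := (((hdot.const_mul (2 * (Real.pi : ℂ) * Complex.I)).cexp).mul
    (ha.differentiable_left ξ x).hasFDerivAt).mul_const z
  refine h.congr_fderiv (ContinuousLinearMap.coe_injective
    ((Pi.basisFun ℝ (Fin N)).ext fun j => ?_))
  have hsum : ∀ c : Fin N → ℂ, (∑ i, (ContinuousLinearMap.proj (R := ℝ)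
      (φ := fun _ : Fin N => ℝ) i).smulRight (c i)) (Pi.single j 1) = c j := by
    intro c
    simp [Pi.single_apply]
  simp only [Pi.basisFun_apply, ContinuousLinearMap.coe_coe, hsum]
  simp [derivSymbol, pdX, dotProdL_apply, dotProd_single]
  ring

theorem IsPolyFamily.hasFDerivAt_oscIntegral {a : T → (Fin N → ℝ) → (Fin N → ℝ) → ℂ}
    (ha : IsPolyFamily a) {g : (Fin N → ℝ) → ℂ} (hg : IsRapidlyDecreasing g) (t : T)
    (x : Fin N → ℝ) :
    HasFDerivAt (oscIntegral (a t) g)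
      (∑ i, (ContinuousLinearMap.proj (R := ℝ) (φ := fun _ : Fin N => ℝ) i).smulRight
        (oscIntegral (_root_.derivSymbol i (a t)) g x)) x := by
  have hK : IsCompact (Metric.closedBall x 1) := isCompact_closedBall x 1
  have hx : x ∈ Metric.closedBall x 1 := Metric.mem_closedBall_self zero_le_one
  obtain ⟨s, hs⟩ := ha.bound []
  obtain ⟨A, hA, hb⟩ := (hs _ hK t).1
  obtain ⟨B, -, hB⟩ := hg.decay (s + (N + 1))
  choose s' hs' using fun i => (ha.derivSymbol i).bound []
  choose A' hA' hb' using fun i => (hs' i _ hK t).1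
  choose B' hB0' hB' using fun i => hg.decay (s' i + (N + 1))
  have hInt (i : Fin N) : Integrable fun ξ =>
      Complex.exp (2 * (Real.pi : ℂ) * Complex.I * (dotProd x ξ : ℂ)) *
        _root_.derivSymbol i (a t) x ξ * g ξ :=
    integrable_phase_mul ((ha.smooth t).derivSymbol i) hg.continuous (hA' i) (hb' i x hx) (hB' i)
  let P : Fin N → (Fin N → ℝ) →L[ℝ] ℝ := fun i => ContinuousLinearMap.proj i
  have hInt' (i : Fin N) := (ContinuousLinearMap.smulRightL ℝ (Fin N → ℝ) ℂ (P i)).integrable_comp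
    (hInt i)
  have key := hasFDerivAt_integral_of_dominated_of_fderiv_le (μ := volume) (𝕜 := ℝ)
    (F := fun x ξ => Complex.exp (2 * (Real.pi : ℂ) * Complex.I * (dotProd x ξ : ℂ)) *
      a t x ξ * g ξ)
    (F' := fun x ξ => ∑ i, (P i).smulRight
        (Complex.exp (2 * (Real.pi : ℂ) * Complex.I * (dotProd x ξ : ℂ)) *
          _root_.derivSymbol i (a t) x ξ * g ξ))
    (bound := fun ξ => ∑ i, ‖P i‖ * (A' i * B' i * (1 + ‖ξ‖) ^ (-((N + 1 : ℕ) : ℝ))))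
    (Metric.closedBall_mem_nhds x one_pos)
    (Eventually.of_forall fun y =>
      (continuous_phase_mul (ha.smooth t) hg.continuous y).aestronglyMeasurable)
    (integrable_phase_mul (ha.smooth t) hg.continuous hA (hb x hx) hB)
    (integrable_finsetSum _ fun i _ => hInt' i).aestronglyMeasurable
    (Eventually.of_forall fun ξ y hy => ?_)
    (integrable_finsetSum _ fun i _ => ((integrable_japanese N).const_mul _).const_mul _)
    (Eventually.of_forall fun ξ y _ => hasFDerivAt_phase_mul (ha.smooth t) (g ξ) y ξ)
  · refine key.congr_fderiv ?_
    refine (integral_finsetSum _ fun i _ => hInt' i).trans (Finset.sum_congr rfl fun i _ => ?_)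
    exact (ContinuousLinearMap.smulRightL ℝ (Fin N → ℝ) ℂ (P i)).integral_comp_comm (hInt i)
  · refine norm_sum_le_of_le _ fun i _ => ?_
    rw [ContinuousLinearMap.norm_smulRight_apply]
    gcongr
    exact norm_phase_mul_le (hA' i) (hb' i y hy ξ) (hB' i ξ)

theorem IsPolyFamily.pd1_oscIntegral {a : T → (Fin N → ℝ) → (Fin N → ℝ) → ℂ}
    (ha : IsPolyFamily a) {g : (Fin N → ℝ) → ℂ} (hg : IsRapidlyDecreasing g) (t : T)
    (i : Fin N) :
    pd1 i (oscIntegral (a t) g) = oscIntegral (_root_.derivSymbol i (a t)) g := by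
  ext x
  simp [pd1, (ha.hasFDerivAt_oscIntegral hg t x).fderiv, Pi.single_apply]

theorem IsPolyFamily.contDiff_oscIntegral {g : (Fin N → ℝ) → ℂ} (hg : IsRapidlyDecreasing g)
    (n : ℕ) : ∀ {a : T → (Fin N → ℝ) → (Fin N → ℝ) → ℂ}, IsPolyFamily a → ∀ t : T,
      ContDiff ℝ n (oscIntegral (a t) g) := by
  induction n with
  | zero =>
    intro a ha t
    exact contDiff_zero.2 (continuous_iff_continuousAt.2 fun x =>
      (ha.hasFDerivAt_oscIntegral hg t x).continuousAt)
  | succ n ih =>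
    intro a ha t
    have h : fderiv ℝ (oscIntegral (a t) g) = fun x => ∑ i,
        ContinuousLinearMap.smulRightL ℝ (Fin N → ℝ) ℂ (ContinuousLinearMap.proj i)
          (oscIntegral (_root_.derivSymbol i (a t)) g x) :=
      funext fun x => (ha.hasFDerivAt_oscIntegral hg t x).fderiv
    push_cast
    refine contDiff_succ_iff_fderiv.2
      ⟨fun x => (ha.hasFDerivAt_oscIntegral hg t x).differentiableAt, by simp, ?_⟩
    rw [h]
    exact ContDiff.sum fun i _ => (ContinuousLinearMap.contDiff _).comp (ih (ha.derivSymbol i) t)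

theorem IsPolyFamily.foldr_derivSymbol {a : T → (Fin N → ℝ) → (Fin N → ℝ) → ℂ}
    (ha : IsPolyFamily a) (L : List (Fin N)) :
    IsPolyFamily fun t => L.foldr _root_.derivSymbol (a t) := by
  induction L with
  | nil => exact ha
  | cons i L ih => exact ih.derivSymbol i

theorem IsPolyFamily.derivList_oscIntegral {a : T → (Fin N → ℝ) → (Fin N → ℝ) → ℂ}
    (ha : IsPolyFamily a) {g : (Fin N → ℝ) → ℂ} (hg : IsRapidlyDecreasing g) (t : T)
    (L : List (Fin N)) :
    derivList L (oscIntegral (a t) g) = oscIntegral (L.foldr _root_.derivSymbol (a t)) g := by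
  induction L with
  | nil => rfl
  | cons i L ih =>
    exact (congrArg (pd1 i) ih).trans ((ha.foldr_derivSymbol L).pd1_oscIntegral hg t i)

/-- The integral depends continuously on the symbol, the density and the point. -/
theorem IsPolyFamily.continuous_oscIntegral {a : T → (Fin N → ℝ) → (Fin N → ℝ) → ℂ}
    (ha : IsPolyFamily a) {g : T → (Fin N → ℝ) → ℂ} (hg : ∀ t, IsRapidlyDecreasing (g t))
    (hgc : ∀ (n : ℕ) (t₀ : T) (ε : ℝ), 0 < ε →
      ∀ᶠ t in nhds t₀, ∀ ξ, (1 + ‖ξ‖) ^ n * ‖g t ξ - g t₀ ξ‖ ≤ ε) :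
    Continuous fun p : T × (Fin N → ℝ) => oscIntegral (a p.1) (g p.1) p.2 := by
  refine continuous_iff_continuousAt.2 fun ⟨t₀, x₀⟩ => ?_
  have hK : IsCompact (Metric.closedBall x₀ 1) := isCompact_closedBall x₀ 1
  obtain ⟨s, hs⟩ := ha.bound []
  obtain ⟨A, hA, hb⟩ := (hs _ hK t₀).1
  obtain ⟨B, hB0, hB⟩ := (hg t₀).decay (s + (N + 1))
  set J := ∫ ξ : Fin N → ℝ, (1 + ‖ξ‖) ^ (-((N + 1 : ℕ) : ℝ))
  have hJ0 : 0 ≤ J := integral_nonneg fun ξ => by positivity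
  have hdiff : Tendsto (fun p : T × (Fin N → ℝ) =>
      oscIntegral (a p.1) (g p.1) p.2 - oscIntegral (a t₀) (g t₀) p.2)
      (nhds (t₀, x₀)) (nhds 0) := by
    rw [Metric.tendsto_nhds]
    intro ε hε
    obtain ⟨η, hη0, hη1, hη⟩ : ∃ η : ℝ, 0 < η ∧ η ≤ 1 ∧ η * ((B + 1 + A) * J) < ε := by
      have hM : 0 < (B + 1 + A) * J + 1 := by positivity
      refine ⟨min 1 (ε / ((B + 1 + A) * J + 1)), by positivity, min_le_left _ _, ?_⟩
      calc _ ≤ ε / ((B + 1 + A) * J + 1) * ((B + 1 + A) * J) := by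
            gcongr
            exact min_le_right _ _
        _ < ε := by
            rw [div_mul_eq_mul_div, div_lt_iff₀ hM]
            nlinarith
    have hev := ((hs _ hK t₀).2 η hη0).and (hgc (s + (N + 1)) t₀ η hη0)
    filter_upwards [(continuous_fst.tendsto (t₀, x₀)).eventually hev,
      (continuous_snd.tendsto (t₀, x₀)).eventually (Metric.closedBall_mem_nhds x₀ one_pos)]
    rintro ⟨t, x⟩ ⟨h₁, h₂⟩ hx
    dsimp only at h₁ h₂ hx ⊢
    have hBt (ξ : Fin N → ℝ) : (1 + ‖ξ‖) ^ (s + (N + 1)) * ‖g t ξ‖ ≤ B + 1 := by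
      have hn : ‖g t ξ‖ ≤ ‖g t₀ ξ‖ + ‖g t ξ - g t₀ ξ‖ := by
        simpa using norm_add_le (g t₀ ξ) (g t ξ - g t₀ ξ)
      calc _ ≤ (1 + ‖ξ‖) ^ (s + (N + 1)) * (‖g t₀ ξ‖ + ‖g t ξ - g t₀ ξ‖) := by gcongr
        _ = (1 + ‖ξ‖) ^ (s + (N + 1)) * ‖g t₀ ξ‖ +
            (1 + ‖ξ‖) ^ (s + (N + 1)) * ‖g t ξ - g t₀ ξ‖ := by ring
        _ ≤ B + 1 := add_le_add (hB ξ) ((h₂ ξ).trans hη1)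
    have hsplit : oscIntegral (a t) (g t) x - oscIntegral (a t₀) (g t₀) x =
        oscIntegral (fun x θ => a t x θ - a t₀ x θ) (g t) x +
          oscIntegral (a t₀) (fun ξ => g t ξ - g t₀ ξ) x := by
      have i₁ := integrable_phase_mul ((ha.smooth t).sub (ha.smooth t₀)) (hg t).continuous
        hη0.le (h₁ x hx) hBt
      have i₂ := integrable_phase_mul (ha.smooth t₀) ((hg t).continuous.sub (hg t₀).continuous)
        hA (hb x hx) h₂
      have i₃ := integrable_phase_mul (ha.smooth t₀) (hg t₀).continuous hA (hb x hx) hB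
      rw [sub_eq_iff_eq_add]
      refine Eq.trans ?_ ((integral_add (i₁.add i₂) i₃).trans
        (congrArg (· + oscIntegral (a t₀) (g t₀) x) (integral_add i₁ i₂)))
      refine integral_congr_ae (Eventually.of_forall fun ξ => ?_)
      simp only [Pi.add_apply, Pi.sub_apply]
      ring
    rw [dist_zero_right, hsplit]
    calc _ ≤ η * (B + 1) * J + A * η * J := (norm_add_le _ _).trans
          (add_le_add (norm_oscIntegral_le hη0.le (h₁ x hx) hBt)
            (norm_oscIntegral_le hA (hb x hx) h₂))
      _ = η * ((B + 1 + A) * J) := by ring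
      _ < ε := hη
  have hbase : Tendsto (fun p : T × (Fin N → ℝ) => oscIntegral (a t₀) (g t₀) p.2)
      (nhds (t₀, x₀)) (nhds (oscIntegral (a t₀) (g t₀) x₀)) :=
    ((ha.hasFDerivAt_oscIntegral (hg t₀) t₀ x₀).continuousAt.tendsto).comp
      (continuous_snd.tendsto (t₀, x₀))
  simpa [ContinuousAt] using hdiff.add hbase

end

/-- Section 4: a continuous family of pseudodifferential operators maps
`C_c^{∞,0}` into `C^{∞,0}`: if `σ` is a continuous family with values in
`S^m_{ρ,δ}(ℝ^N × ℝ^N)` and `f : T × ℝ^N → ℂ` is continuous with compact support, each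
`f^t` smooth with `t ↦ f^t` continuous into `C^∞(ℝ^N)`, then `Af(t,x) = A_{σ^t} f^t (x)`
is a `C^{∞,0}` function: each `Af(t, ·)` is smooth and every `x`-derivative of `Af` is
jointly continuous in `(t,x)`. -/
theorem pdo_family_maps_CinftyZero
    {T : Type*} [TopologicalSpace T] [LocallyCompactSpace T] [T2Space T]
    {N : ℕ} (hN : 1 ≤ N)
    (ρ δ : ℝ) (hδ0 : 0 ≤ δ) (hδρ : δ < ρ) (hρ1 : ρ ≤ 1) (m : ℝ)
    (σ : T → (Fin N → ℝ) → (Fin N → ℝ) → ℂ)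
    (hσ : IsContinuousSymbolFamily ρ δ m Set.univ σ)
    (f : T → (Fin N → ℝ) → ℂ)
    (hfcont : Continuous fun p : T × (Fin N → ℝ) => f p.1 p.2)
    (hfsupp : HasCompactSupport fun p : T × (Fin N → ℝ) => f p.1 p.2)
    (hfsmooth : ∀ t : T, ContDiff ℝ (⊤ : ℕ∞) (f t))
    (hfC : ∀ t₀ : T, ∀ k : ℕ, ∀ K : Set (Fin N → ℝ), IsCompact K → ∀ ε : ℝ, 0 < ε →
      ∀ᶠ t in nhds t₀, ∀ x ∈ K,
        ‖iteratedFDeriv ℝ k (f t) x - iteratedFDeriv ℝ k (f t₀) x‖ ≤ ε) :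
    (∀ t : T, ContDiff ℝ (⊤ : ℕ∞) (fun x => pdoApply (σ t) (f t) x)) ∧
    ∀ L : List (Fin N),
      Continuous fun p : T × (Fin N → ℝ) =>
        derivList L (fun x => pdoApply (σ p.1) (f p.1) x) p.2 := by
  have hσ' := hσ.isPolyFamily
  set K : Set (Fin N → ℝ) :=
    Set.image Prod.snd (tsupport fun p : T × (Fin N → ℝ) => f p.1 p.2)
  have hK : IsCompact K := IsCompact.image hfsupp continuous_snd
  have hf0 (t : T) : ∀ x ∉ K, f t x = 0 := fun x hx => by
    by_contra hne
    exact hx ⟨(t, x), subset_tsupport _ hne, rfl⟩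
  have hfint (t : T) : Integrable (f t) :=
    (hfsmooth t).continuous.integrable_of_hasCompactSupport (HasCompactSupport.intro hK (hf0 t))
  have hg (t : T) : IsRapidlyDecreasing (fourierT (f t)) := by
    refine ⟨continuous_fourierT (hfint t), fun n => ?_⟩
    obtain ⟨C, hC, hdecay⟩ := exists_fourierT_decay hN hK n
    choose b hb using fun q : ℕ => hK.exists_bound_of_continuousOn
      ((hfsmooth t).continuous_iteratedFDeriv (m := q) (mod_cast le_top)).continuousOn
    refine ⟨C * ∑ q ∈ Finset.range (n + 1), |b q|, by positivity,
      hdecay (f t) (hfsmooth t) (hf0 t) _ fun q hq x hx => ?_⟩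
    exact ((hb q x hx).trans (le_abs_self _)).trans (Finset.single_le_sum
      (f := fun q => |b q|) (fun _ _ => abs_nonneg _) (Finset.mem_range.2 (by omega)))
  have hgc (n : ℕ) (t₀ : T) (ε : ℝ) (hε : 0 < ε) : ∀ᶠ t in nhds t₀, ∀ ξ,
      (1 + ‖ξ‖) ^ n * ‖fourierT (f t) ξ - fourierT (f t₀) ξ‖ ≤ ε := by
    obtain ⟨C, hC, hdecay⟩ := exists_fourierT_decay hN hK n
    have hev : ∀ᶠ t in nhds t₀, ∀ q ∈ Finset.range (n + 1), ∀ x ∈ K,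
        ‖iteratedFDeriv ℝ q (f t) x - iteratedFDeriv ℝ q (f t₀) x‖ ≤ ε / (C + 1) :=
      (Finset.eventually_all _).2 fun q _ => hfC t₀ q K hK _ (by positivity)
    filter_upwards [hev] with t ht ξ
    rw [← fourierT_sub (hfint t) (hfint t₀)]
    refine (hdecay _ ((hfsmooth t).sub (hfsmooth t₀)) (fun x hx => by simp [hf0 _ x hx])
      (ε / (C + 1)) (fun q hq x hx => ?_) ξ).trans ?_
    · change ‖iteratedFDeriv ℝ q (f t - f t₀) x‖ ≤ _
      rw [iteratedFDeriv_sub_apply ((hfsmooth t).of_le (mod_cast le_top)).contDiffAt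
        ((hfsmooth t₀).of_le (mod_cast le_top)).contDiffAt]
      exact ht q (Finset.mem_range.2 (by omega)) x hx
    · rw [mul_div_assoc', div_le_iff₀ (by positivity)]
      nlinarith
  refine ⟨fun t => contDiff_infty.2 fun n => hσ'.contDiff_oscIntegral (hg t) n t, fun L => ?_⟩
  refine ((hσ'.foldr_derivSymbol L).continuous_oscIntegral hg hgc).congr fun p => ?_
  exact (congrFun (hσ'.derivList_oscIntegral (hg p.1) p.1 L) p.2).symm
end
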